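/- arXiv:2210.10577 — 3 statements merged into one kernel-verified Lean document; each statement's English description precedes it below -/
import Mathlib

section
/- Let t_n denote the n-th term of the triangular quilt sequence and let 6 ≤ n ≤ 50 be an integer. Then t_{n+1} = t_n + t_{n−5} holds if, and only if, n ∈ {6, 8, 10, 12, 14, 16, 18, 20, 22, 24, 26, 31, 33, 35, 37, 39, 41, 43, 46, 48}. -/
/-- Indices `i` and `j` are adjacent in the triangular quilt. -/
def TriAdj (i j : ℕ) : Prop :=
  ((i : ℤ) - (j : ℤ)).natAbs ∈ ({1, 5} : Set ℕ) ∨ ({i, j} : Set ℕ) = {1, 4}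

/-- `t` is the triangular quilt sequence (indexed from `1`; `t 0` unconstrained). -/
def IsTriQuiltSeq (t : ℕ → ℕ) : Prop :=
  ∀ n, 1 ≤ n → IsLeast {m | 0 < m ∧
    ¬ ∃ L : Finset ℕ, L ⊆ Finset.Icc 1 (n - 1) ∧
      (∀ i ∈ L, ∀ j ∈ L, ¬ TriAdj i j) ∧
      m = ∑ ℓ ∈ L, t ℓ} (t n)

/-- Apply `k` to `x`, written as a recursion so that the kernel evaluates `x` to a numeral first. -/
def force {α : Type} (x : ℕ) (k : ℕ → α) : α :=
  Nat.rec (k 0) (fun m _ => k (Nat.succ m)) x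

theorem force_eq {α : Type} (x : ℕ) (k : ℕ → α) : force x k = k x := by
  cases x <;> rfl

/-- The set of distances `d` such that choosing the index `n` forbids the index `n - 1 - d`,
encoded in binary. -/
def adjMask (n : ℕ) : ℕ := cond (Nat.beq n 4) 21 17

/-- `v` is the sum of `u` over a set of pairwise non-adjacent indices in `{1, ..., n}`, none of
which is of the form `n - d` with the `d`-th binary digit of `s` equal to `1`. -/
def Representable (u : ℕ → ℕ) (n s v : ℕ) : Prop :=
  ∃ L : Finset ℕ, L ⊆ Finset.Icc 1 n ∧ (∀ i ∈ L, ∀ j ∈ L, ¬ TriAdj i j) ∧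
    (∀ i ∈ L, s.testBit (n - i) = false) ∧ v = ∑ ℓ ∈ L, u ℓ

theorem triAdj_iff (i j : ℕ) :
    TriAdj i j ↔ i = j + 1 ∨ j = i + 1 ∨ i = j + 5 ∨ j = i + 5 ∨
      (i = 1 ∧ j = 4) ∨ (i = 4 ∧ j = 1) := by
  unfold TriAdj
  rw [Set.pair_eq_pair_iff]
  simp only [Set.mem_insert_iff, Set.mem_singleton_iff]
  omega

theorem TriAdj.symm {i j : ℕ} (h : TriAdj i j) : TriAdj j i := by
  rw [triAdj_iff] at *
  omega

theorem testBit_adjMask {n i : ℕ} (hi : 1 ≤ i) (hn : i ≤ n) :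
    (adjMask (n + 1)).testBit (n - i) = true ↔ TriAdj (n + 1) i := by
  rw [triAdj_iff]
  have h17 : ∀ d, Nat.testBit 17 d = true ↔ d = 0 ∨ d = 4 := fun d => by
    rcases lt_or_ge d 5 with hd | hd
    · interval_cases d <;> decide
    · rw [Nat.testBit_lt_two_pow (lt_of_lt_of_le (by norm_num : 17 < 2 ^ 5)
        (Nat.pow_le_pow_right (by norm_num) hd))]
      simp
      omega
  by_cases h : n = 3
  · subst h
    interval_cases i <;> decide
  · have hm : adjMask (n + 1) = 17 := by
      have : Nat.beq (n + 1) 4 = false := by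
        rw [← Bool.not_eq_true, Nat.beq_eq]
        omega
      simp [adjMask, this]
    rw [hm, h17]
    omega

theorem representable_zero_left (u : ℕ → ℕ) (s : ℕ) : Representable u 0 s 0 :=
  ⟨∅, by simp, by simp, by simp, by simp⟩

theorem Representable.eq_zero {u : ℕ → ℕ} {s v : ℕ} (h : Representable u 0 s v) : v = 0 := by
  obtain ⟨L, hL, -, -, rfl⟩ := h
  have : L = ∅ := by simpa using hL
  simp [this]

theorem Representable.skip {u : ℕ → ℕ} {n s v : ℕ} (h : Representable u n (s >>> 1) v) :
    Representable u (n + 1) s v := by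
  obtain ⟨L, hL, hind, hs, hv⟩ := h
  refine ⟨L, hL.trans (Finset.Icc_subset_Icc_right n.le_succ), hind, fun i hi => ?_, hv⟩
  have h1 := hs i hi
  have h2 := Finset.mem_Icc.1 (hL hi)
  rw [Nat.testBit_shiftRight] at h1
  rwa [show n + 1 - i = 1 + (n - i) by omega]

theorem Representable.use {u : ℕ → ℕ} {n s v : ℕ} (h0 : s % 2 = 0)
    (h : Representable u n ((s >>> 1) ||| adjMask (n + 1)) v) :
    Representable u (n + 1) s (u (n + 1) + v) := by
  obtain ⟨L, hL, hind, hs, rfl⟩ := h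
  have hmem : ∀ i ∈ L, 1 ≤ i ∧ i ≤ n := fun i hi => Finset.mem_Icc.1 (hL hi)
  have hadj : ∀ i ∈ L, ¬ TriAdj (n + 1) i := fun i hi hc => by
    have h1 := hs i hi
    rw [← testBit_adjMask (hmem i hi).1 (hmem i hi).2] at hc
    simp [hc] at h1
  have hself : ¬ TriAdj (n + 1) (n + 1) := by
    rw [triAdj_iff]
    omega
  refine ⟨insert (n + 1) L, ?_, ?_, ?_, ?_⟩
  · intro i hi
    rcases Finset.mem_insert.1 hi with rfl | hi
    · simp
    · have := hmem i hi
      simp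
      omega
  · intro i hi j hj
    rcases Finset.mem_insert.1 hi with rfl | hi <;> rcases Finset.mem_insert.1 hj with rfl | hj
    · exact hself
    · exact hadj j hj
    · exact fun hc => hadj i hi hc.symm
    · exact hind i hi j hj
  · intro i hi
    rcases Finset.mem_insert.1 hi with rfl | hi
    · simp [Nat.testBit_zero, h0]
    · have h1 := hs i hi
      rw [Nat.testBit_or, Bool.or_eq_false_iff, Nat.testBit_shiftRight] at h1
      rw [show n + 1 - i = 1 + (n - i) by have := hmem i hi; omega]
      exact h1.1
  · rw [Finset.sum_insert]
    intro hc
    have := hmem _ hc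
    omega

theorem Representable.skip_or_use {u : ℕ → ℕ} {n s v : ℕ} (h : Representable u (n + 1) s v) :
    Representable u n (s >>> 1) v ∨
      (s % 2 = 0 ∧ ∃ w, v = u (n + 1) + w ∧
        Representable u n ((s >>> 1) ||| adjMask (n + 1)) w) := by
  obtain ⟨L, hL, hind, hs, rfl⟩ := h
  have hbit : ∀ i ∈ L, i ≤ n → (s >>> 1).testBit (n - i) = false := fun i hi hin => by
    rw [Nat.testBit_shiftRight, show 1 + (n - i) = n + 1 - i by omega]
    exact hs i hi
  by_cases hn : n + 1 ∈ L
  · right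
    have hmem : ∀ i ∈ L.erase (n + 1), i ∈ L ∧ 1 ≤ i ∧ i ≤ n := fun i hi => by
      have h1 := Finset.mem_erase.1 hi
      have h2 := Finset.mem_Icc.1 (hL h1.2)
      exact ⟨h1.2, h2.1, by omega⟩
    refine ⟨?_, ∑ ℓ ∈ L.erase (n + 1), u ℓ, (Finset.add_sum_erase L u hn).symm,
      L.erase (n + 1), fun i hi => Finset.mem_Icc.2 (hmem i hi).2,
      fun i hi j hj => hind i (hmem i hi).1 j (hmem j hj).1, fun i hi => ?_, rfl⟩
    · have := hs _ hn
      simp [Nat.testBit_zero] at this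
      omega
    · obtain ⟨h1, h2, h3⟩ := hmem i hi
      rw [Nat.testBit_or, hbit i h1 h3, Bool.false_or, ← Bool.not_eq_true,
        testBit_adjMask h2 h3]
      exact hind _ hn i h1
  · left
    have hmem : ∀ i ∈ L, 1 ≤ i ∧ i ≤ n := fun i hi => by
      have h2 := Finset.mem_Icc.1 (hL hi)
      have h3 : i ≠ n + 1 := fun hc => hn (hc ▸ hi)
      omega
    exact ⟨L, fun i hi => Finset.mem_Icc.2 (hmem i hi), hind,
      fun i hi => hbit i hi (hmem i hi).2, rfl⟩

/-- The recursion step of `maxSum`. -/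
def maxSumStep (u : ℕ → ℕ) (n : ℕ) (ih : ℕ → ℕ) (s : ℕ) : ℕ :=
  force (Nat.shiftRight s 1) fun s₀ =>
  force (Nat.lor s₀ (adjMask (Nat.succ n))) fun s₁ =>
  force (ih s₀) fun a =>
  cond (Nat.beq (Nat.mod s 2) 0)
    (force (Nat.add (u (Nat.succ n)) (ih s₁)) fun b => cond (Nat.ble a b) b a) a

/-- The largest `v` with `Representable u n s v`. -/
def maxSum (u : ℕ → ℕ) (n : ℕ) : ℕ → ℕ :=
  Nat.rec (fun _ => 0) (maxSumStep u) n

theorem maxSum_succ (u : ℕ → ℕ) (n s : ℕ) :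
    maxSum u (n + 1) s = cond (Nat.beq (s % 2) 0)
      (cond (Nat.ble (maxSum u n (s >>> 1))
          (u (n + 1) + maxSum u n ((s >>> 1) ||| adjMask (n + 1))))
        (u (n + 1) + maxSum u n ((s >>> 1) ||| adjMask (n + 1))) (maxSum u n (s >>> 1)))
      (maxSum u n (s >>> 1)) := by
  change maxSumStep u n (maxSum u n) s = _
  simp only [maxSumStep, force_eq]
  rfl

theorem Representable.le_maxSum {u : ℕ → ℕ} {n s v : ℕ} (h : Representable u n s v) :
    v ≤ maxSum u n s := by
  induction n generalizing s v with
  | zero => exact h.eq_zero.le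
  | succ n ih =>
    rw [maxSum_succ]
    rcases h.skip_or_use with h' | ⟨h0, w, rfl, h'⟩
    · have := ih h'
      cases h1 : Nat.beq (s % 2) 0
      · exact this
      · cases h2 : Nat.ble (maxSum u n (s >>> 1))
          (u (n + 1) + maxSum u n ((s >>> 1) ||| adjMask (n + 1)))
        · exact this
        · exact this.trans (Nat.le_of_ble_eq_true h2)
    · have := ih h'
      have h1 : Nat.beq (s % 2) 0 = true := by rw [h0]; rfl
      rw [h1]
      cases h2 : Nat.ble (maxSum u n (s >>> 1))
          (u (n + 1) + maxSum u n ((s >>> 1) ||| adjMask (n + 1)))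
      · rw [← Bool.not_eq_true, Nat.ble_eq] at h2
        simp only [cond_true, cond_false]
        omega
      · simp only [cond_true]
        omega

/-- The recursion step of `isRepresentable`. -/
def isRepresentableStep (u : ℕ → ℕ) (n : ℕ) (ih : ℕ → ℕ → Bool) (s v : ℕ) : Bool :=
  force (Nat.shiftRight s 1) fun s₀ =>
  force (Nat.lor s₀ (adjMask (Nat.succ n))) fun s₁ =>
  cond (Nat.ble v (maxSum u (Nat.succ n) s))
    (cond (ih s₀ v) true
      (cond (Nat.beq (Nat.mod s 2) 0)
        (cond (Nat.ble (u (Nat.succ n)) v)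
          (force (Nat.sub v (u (Nat.succ n))) fun w => ih s₁ w) false) false)) false

/-- A decision procedure for `Representable u n s v`. -/
def isRepresentable (u : ℕ → ℕ) (n : ℕ) : ℕ → ℕ → Bool :=
  Nat.rec (fun _ v => Nat.beq v 0) (isRepresentableStep u) n

theorem isRepresentable_succ (u : ℕ → ℕ) (n s v : ℕ) :
    isRepresentable u (n + 1) s v =
      cond (Nat.ble v (maxSum u (n + 1) s))
        (cond (isRepresentable u n (s >>> 1) v) true
          (cond (Nat.beq (s % 2) 0)
            (cond (Nat.ble (u (n + 1)) v)
              (isRepresentable u n ((s >>> 1) ||| adjMask (n + 1)) (v - u (n + 1)))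
              false) false)) false := by
  change isRepresentableStep u n (isRepresentable u n) s v = _
  simp only [isRepresentableStep, force_eq]
  rfl

theorem Representable.isRepresentable {u : ℕ → ℕ} {n s v : ℕ} (h : Representable u n s v) :
    isRepresentable u n s v = true := by
  induction n generalizing s v with
  | zero => rw [h.eq_zero]; rfl
  | succ n ih =>
    rw [isRepresentable_succ, Nat.ble_eq_true_of_le h.le_maxSum]
    rcases h.skip_or_use with h' | ⟨h0, w, rfl, h'⟩
    · rw [ih h']
      rfl
    · have h1 : Nat.beq (s % 2) 0 = true := by rw [h0]; rfl
      rw [h1, Nat.ble_eq_true_of_le (Nat.le_add_right _ _), Nat.add_sub_cancel_left, ih h']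
      cases _root_.isRepresentable u n (s >>> 1) (u (n + 1) + w) <;> rfl

/-- Extend an interval ending at `e` at most `fuel` times, alternately by sums without and with the
term `u (n + 1)`; `run₀` and `run₁` extend intervals of the respective sums of the terms up to
`u n`, and `free` tells whether the index `n + 1` may be used. -/
def extendRun (u : ℕ → ℕ) (n : ℕ) (run₀ run₁ : ℕ → ℕ) (free : Bool) (fuel : ℕ) : ℕ → ℕ :=
  Nat.rec (fun e => e)
    (fun _ extend e =>
      force (run₀ e) fun e₁ =>
      force (cond free
        (cond (Nat.ble (u (Nat.succ n)) e₁)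
          (force (Nat.sub e₁ (u (Nat.succ n))) fun w =>
            Nat.add (u (Nat.succ n)) (run₁ w)) e₁) e₁) fun e₂ =>
      cond (Nat.beq e₂ e) e (extend e₂)) fuel

theorem extendRun_succ (u : ℕ → ℕ) (n : ℕ) (run₀ run₁ : ℕ → ℕ) (free : Bool) (fuel e e₂ : ℕ)
    (he₂ : cond free (cond (Nat.ble (u (n + 1)) (run₀ e))
      (u (n + 1) + run₁ (run₀ e - u (n + 1))) (run₀ e)) (run₀ e) = e₂) :
    extendRun u n run₀ run₁ free (fuel + 1) e =
      cond (Nat.beq e₂ e) e (extendRun u n run₀ run₁ free fuel e₂) := by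
  subst he₂
  unfold extendRun
  simp only [force_eq]
  rfl

/-- The recursion step of `runEnd`. -/
def runEndStep (u : ℕ → ℕ) (n : ℕ) (ih : ℕ → ℕ → ℕ) (s a : ℕ) : ℕ :=
  force (Nat.shiftRight s 1) fun s₀ =>
  force (Nat.lor s₀ (adjMask (Nat.succ n))) fun s₁ =>
  cond (Nat.ble a (maxSum u (Nat.succ n) s))
    (extendRun u n (ih s₀) (ih s₁) (Nat.beq (Nat.mod s 2) 0) 40 a) a

/-- An `e` such that all `m` with `a ≤ m < e` satisfy `Representable u n s m`. -/
def runEnd (u : ℕ → ℕ) (n : ℕ) : ℕ → ℕ → ℕ :=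
  Nat.rec (fun _ a => cond (Nat.beq a 0) 1 a) (runEndStep u) n

theorem runEnd_succ (u : ℕ → ℕ) (n s a : ℕ) :
    runEnd u (n + 1) s a = cond (Nat.ble a (maxSum u (n + 1) s))
      (extendRun u n (runEnd u n (s >>> 1)) (runEnd u n ((s >>> 1) ||| adjMask (n + 1)))
        (Nat.beq (s % 2) 0) 40 a) a := by
  change runEndStep u n (runEnd u n) s a = _
  simp only [runEndStep, force_eq]
  rfl

theorem representable_of_lt_extendRun {u : ℕ → ℕ} {n s a m fuel : ℕ} {run₀ run₁ : ℕ → ℕ}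
    (h₀ : ∀ {e m}, e ≤ m → m < run₀ e → Representable u n (s >>> 1) m)
    (h₁ : ∀ {e m}, e ≤ m → m < run₁ e → Representable u n ((s >>> 1) ||| adjMask (n + 1)) m)
    (ha : a ≤ m) (hm : m < extendRun u n run₀ run₁ (Nat.beq (s % 2) 0) fuel a) :
    Representable u (n + 1) s m := by
  induction fuel generalizing a with
  | zero => exact absurd hm (not_lt.2 ha)
  | succ fuel ih =>
    by_cases hm₁ : m < run₀ a
    · exact (h₀ ha hm₁).skip
    obtain ⟨e₂, he₂⟩ : ∃ e₂, cond (Nat.beq (s % 2) 0) (cond (Nat.ble (u (n + 1)) (run₀ a))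
      (u (n + 1) + run₁ (run₀ a - u (n + 1))) (run₀ a)) (run₀ a) = e₂ := ⟨_, rfl⟩
    rw [extendRun_succ _ _ _ _ _ _ _ _ he₂] at hm
    by_cases hm₂ : m < e₂
    · cases hs : Nat.beq (s % 2) 0 <;> rw [hs] at he₂ <;>
        simp only [cond_true, cond_false] at he₂
      · omega
      cases hu : Nat.ble (u (n + 1)) (run₀ a) <;> rw [hu] at he₂ <;>
        simp only [cond_true, cond_false] at he₂
      · omega
      have hle := Nat.le_of_ble_eq_true hu
      have := (h₁ (e := run₀ a - u (n + 1)) (m := m - u (n + 1)) (by omega) (by omega)).use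
        (Nat.eq_of_beq_eq_true hs)
      rwa [Nat.add_sub_cancel' (by omega)] at this
    · cases he : Nat.beq e₂ a <;> rw [he] at hm <;> simp only [cond_true, cond_false] at hm
      · exact ih (not_lt.1 hm₂) hm
      · omega

theorem representable_of_lt_runEnd {u : ℕ → ℕ} {n s a m : ℕ} (ha : a ≤ m)
    (hm : m < runEnd u n s a) : Representable u n s m := by
  induction n generalizing s a m with
  | zero =>
    have h : runEnd u 0 s a = cond (Nat.beq a 0) 1 a := rfl
    rw [h] at hm
    cases h1 : Nat.beq a 0 <;> rw [h1] at hm <;> simp only [cond_true, cond_false] at hm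
    · omega
    · obtain rfl : m = 0 := by omega
      exact representable_zero_left u s
  | succ n ih =>
    rw [runEnd_succ] at hm
    cases h1 : Nat.ble a (maxSum u (n + 1) s) <;> rw [h1] at hm <;>
      simp only [cond_true, cond_false] at hm
    · omega
    · exact representable_of_lt_extendRun ih ih ha hm

/-- The first terms of the triangular quilt sequence, preceded by a dummy term. -/
def quiltTerm (n : ℕ) : ℕ :=
  [0, 1, 2, 3, 5, 6, 11, 12, 20, 23, 40, 46, 80, 92, 152, 175, 295, 341, 573, 665, 1164, 1339,
    2219, 2560, 4320, 4985, 8425, 9764, 13450, 17060, 21856, 38649, 47074, 76996, 90446, 153550,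
    175406, 295775, 342849, 595251, 685697, 1183438, 1358844, 2262151, 2605000, 3741052, 4818750,
    6002188, 10454027, 12716178, 17533346, 27499378].getD n 0

theorem quiltTerm_spec :
    (List.range 51).all (fun n =>
      cond (Nat.beq (runEnd quiltTerm n 0 0) (quiltTerm (Nat.succ n)))
        (cond (isRepresentable quiltTerm n 0 (quiltTerm (Nat.succ n))) false
          (Nat.ble 1 (quiltTerm (Nat.succ n)))) false) = true := by
  decide +kernel

theorem isLeast_quiltTerm {n : ℕ} (hn : n < 51) :
    IsLeast {m | 0 < m ∧ ¬ Representable quiltTerm n 0 m} (quiltTerm (n + 1)) := by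
  have h := List.all_eq_true.1 quiltTerm_spec n (List.mem_range.2 hn)
  cases h1 : Nat.beq (runEnd quiltTerm n 0 0) (quiltTerm (Nat.succ n)) <;> rw [h1] at h
  · cases h
  cases h2 : isRepresentable quiltTerm n 0 (quiltTerm (Nat.succ n)) <;> rw [h2] at h
  · refine ⟨⟨Nat.le_of_ble_eq_true h, fun hr => ?_⟩, fun m hm => not_lt.1 fun hlt => hm.2 ?_⟩
    · have := hr.isRepresentable
      simp_all
    · exact representable_of_lt_runEnd (a := 0) (Nat.zero_le m)
        (by rwa [Nat.eq_of_beq_eq_true h1])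
  · cases h

theorem IsTriQuiltSeq.eq_quiltTerm {t : ℕ → ℕ} (ht : IsTriQuiltSeq t) {n : ℕ} (h1 : 1 ≤ n)
    (h51 : n ≤ 51) : t n = quiltTerm n := by
  induction n using Nat.strong_induction_on with
  | _ n ih =>
    have h := isLeast_quiltTerm (n := n - 1) (by omega)
    rw [Nat.sub_add_cancel h1] at h
    refine (ht n h1).unique (Eq.subst (motive := fun S => IsLeast S (quiltTerm n))
      (Set.ext fun m => and_congr_right fun _ => not_congr <| exists_congr fun L =>
        and_congr_right fun hL => and_congr_right fun _ => ?_) h)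
    have hsum : ∑ ℓ ∈ L, t ℓ = ∑ ℓ ∈ L, quiltTerm ℓ := Finset.sum_congr rfl fun i hi => by
      have := Finset.mem_Icc.1 (hL hi)
      exact ih i (by omega) this.1 (by omega)
    simp [hsum]

theorem triangular_quilt_recurrence (t : ℕ → ℕ) (ht : IsTriQuiltSeq t)
    (n : ℕ) (h1 : 6 ≤ n) (h2 : n ≤ 50) :
    t (n + 1) = t n + t (n - 5) ↔
      n ∈ ({6, 8, 10, 12, 14, 16, 18, 20, 22, 24, 26, 31, 33, 35, 37, 39,
            41, 43, 46, 48} : Finset ℕ) := by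
  rw [ht.eq_quiltTerm (n := n + 1) (by omega) (by omega),
    ht.eq_quiltTerm (n := n) (by omega) (by omega),
    ht.eq_quiltTerm (n := n - 5) (by omega) (by omega)]
  interval_cases n <;> decide
end

section
/- Let (a_n)_{n≥1} be the {3}-LID sequence and let 4 ≤ n ≤ 40 be an integer. Then a_{n+1} = a_n + a_{n−3} holds if, and only if, n ∈ {4, 5, 6, 7, 8, 10, 12, 15}. -/
/-- `L` is an `S`-legal index set: all pairwise index differences avoid `S`. -/
def SlidLegal (S : Set ℕ) (L : Finset ℕ) : Prop :=
  ∀ i ∈ L, ∀ j ∈ L, ((i : ℤ) - (j : ℤ)).natAbs ∉ S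

/-- `m` has an `S`-LID decomposition using the terms `a 1, …, a n`. -/
def SlidDecomp (S : Set ℕ) (a : ℕ → ℕ) (n m : ℕ) : Prop :=
  ∃ L : Finset ℕ, L ⊆ Finset.Icc 1 n ∧ SlidLegal S L ∧ m = ∑ ℓ ∈ L, a ℓ

/-- `a` is the `S`-LID sequence (indexed from `1`; `a 0` is unconstrained):
for each `n ≥ 1`, `a n` is the least positive integer with no `S`-LID
decomposition using `a 1, …, a (n-1)`. -/
def IsSlidSeq (S : Set ℕ) (a : ℕ → ℕ) : Prop :=
  ∀ n, 1 ≤ n → IsLeast {m | 0 < m ∧ ¬ SlidDecomp S a (n - 1) m} (a n)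

/-- The bit mask of the sums of `{3}`-legal index sets `L ⊆ {1, …, n}`; the flags `p`, `q`, `r` say
whether `n`, `n - 1`, `n - 2` may belong to `L`. -/
def sumMask (a : ℕ → ℕ) : ℕ → Bool → Bool → Bool → ℕ
  | 0, _, _, _ => 1
  | n + 1, true, q, r =>
      Nat.lor (sumMask a n q r true) (Nat.shiftLeft (sumMask a n q r false) (a (n + 1)))
  | n + 1, false, q, r => sumMask a n q r true

theorem SlidLegal.mono {S : Set ℕ} {L L' : Finset ℕ} (h : SlidLegal S L) (hL : L' ⊆ L) :
    SlidLegal S L' :=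
  fun i hi j hj => h i (hL hi) j (hL hj)

theorem testBit_sumMask (a : ℕ → ℕ) (n : ℕ) (p q r : Bool) (m : ℕ) :
    (sumMask a n p q r).testBit m = true ↔
      ∃ L : Finset ℕ, L ⊆ Finset.Icc 1 n ∧ SlidLegal {3} L ∧ (p = false → n ∉ L) ∧
        (q = false → n - 1 ∉ L) ∧ (r = false → n - 2 ∉ L) ∧ m = ∑ ℓ ∈ L, a ℓ := by
  induction n generalizing p q r m with
  | zero =>
    simp only [sumMask, Nat.testBit_one_eq_true_iff_self_eq_zero]
    constructor
    · rintro rfl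
      exact ⟨∅, by simp, by simp [SlidLegal], by simp⟩
    · rintro ⟨L, hL, -, -, -, -, rfl⟩
      have : L = ∅ := by simpa using hL
      simp [this]
  | succ n ih =>
    have skip (L : Finset ℕ) : (L ⊆ Finset.Icc 1 (n + 1) ∧ n + 1 ∉ L) ↔ L ⊆ Finset.Icc 1 n := by
      constructor
      · rintro ⟨hL, hn⟩ i hi
        have := Finset.mem_Icc.1 (hL hi)
        have : i ≠ n + 1 := fun h => hn (h ▸ hi)
        exact Finset.mem_Icc.2 (by omega)
      · intro hL
        refine ⟨hL.trans (Finset.Icc_subset_Icc_right (by omega)), fun h => ?_⟩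
        have := Finset.mem_Icc.1 (hL h)
        omega
    cases p with
    | false =>
      simp only [sumMask, ih]
      refine exists_congr fun L => ?_
      rw [← skip L]
      simp only [Nat.add_sub_cancel, show n + 1 - 2 = n - 1 by omega]
      tauto
    | true =>
      change (sumMask a n q r true ||| sumMask a n q r false <<< a (n + 1)).testBit m = true ↔ _
      rw [Nat.testBit_or, Nat.testBit_shiftLeft, Bool.or_eq_true, Bool.and_eq_true, ih, ih]
      simp only [decide_eq_true_eq, Nat.add_sub_cancel, show n + 1 - 2 = n - 1 by omega]
      constructor
      · rintro (⟨L, hL, hleg, hq, hr, -, hm⟩ | ⟨hle, L, hL, hleg, hq, hr, hs, hm⟩)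
        · exact ⟨L, ((skip L).2 hL).1, hleg, by simp, hq, hr, hm⟩
        · obtain ⟨hL', hn⟩ := (skip L).2 hL
          refine ⟨insert (n + 1) L, ?_, ?_, by simp, ?_, ?_, ?_⟩
          · exact Finset.insert_subset (by simp) hL'
          · have key : ∀ i ∈ L, i + 3 ≠ n + 1 := by
              intro i hi h
              have : i = n - 2 := by omega
              exact hs trivial (this ▸ hi)
            intro i hi j hj
            rcases Finset.mem_insert.1 hi with rfl | hi' <;>
              rcases Finset.mem_insert.1 hj with rfl | hj'
            · simp
            · have := key j hj'
              have := Finset.mem_Icc.1 (hL hj')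
              simp only [Set.mem_singleton_iff]
              omega
            · have := key i hi'
              have := Finset.mem_Icc.1 (hL hi')
              simp only [Set.mem_singleton_iff]
              omega
            · exact hleg i hi' j hj'
          · intro h
            simpa using hq h
          · intro h
            have : n - 1 ≠ n + 1 := by omega
            simpa [this] using hr h
          · rw [Finset.sum_insert hn]
            omega
      · rintro ⟨L, hL, hleg, -, hq, hr, hm⟩
        by_cases hn : n + 1 ∈ L
        · right
          have hsum := Finset.add_sum_erase L a hn
          refine ⟨by omega, L.erase (n + 1), ?_, hleg.mono (Finset.erase_subset _ _), ?_, ?_, ?_, ?_⟩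
          · exact (skip _).1 ⟨(Finset.erase_subset _ _).trans hL, Finset.notMem_erase _ _⟩
          · exact fun h h' => hq h (Finset.mem_of_mem_erase h')
          · exact fun h h' => hr h (Finset.mem_of_mem_erase h')
          · intro _ h'
            have hmem := Finset.mem_of_mem_erase h'
            have := Finset.mem_Icc.1 (hL hmem)
            refine hleg _ hn _ hmem ?_
            simp only [Set.mem_singleton_iff]
            omega
          · omega
        · left
          exact ⟨L, (skip L).1 ⟨hL, hn⟩, hleg, hq, hr, by simp, hm⟩

theorem slidDecomp_three_iff (a : ℕ → ℕ) (n m : ℕ) :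
    SlidDecomp {3} a n m ↔ (sumMask a n true true true).testBit m = true := by
  simp [testBit_sumMask, SlidDecomp]

theorem IsSlidSeq.eq_of_sumMask_mod {a : ℕ → ℕ} (ha : IsSlidSeq {3} a) {n v : ℕ}
    (h : sumMask a n true true true % 2 ^ (v + 1) = 2 ^ v - 1) : a (n + 1) = v := by
  have hbit (m : ℕ) (hm : m ≤ v) :
      (sumMask a n true true true).testBit m = true ↔ m < v := by
    have := congrArg (fun x => x.testBit m) h
    simp only [Nat.testBit_mod_two_pow, Nat.testBit_two_pow_sub_one] at this
    simpa [Nat.lt_succ_of_le hm] using congrArg (· = true) this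
  refine (ha (n + 1) (by omega)).unique ⟨⟨?_, ?_⟩, ?_⟩
  · rw [← hbit 0 (Nat.zero_le v), ← slidDecomp_three_iff]
    exact ⟨∅, by simp, by simp [SlidLegal], by simp⟩
  · simp [slidDecomp_three_iff, hbit v le_rfl]
  · rintro m ⟨-, hm⟩
    by_contra! hlt
    rw [Nat.add_sub_cancel, slidDecomp_three_iff, hbit m hlt.le] at hm
    exact hm hlt

/-- Checks that the terms of a list continue a `{3}`-LID sequence whose eight masks `sumMask`
are given; the digits in the name of a mask are its flags. -/
def checkTerms : List ℕ → (t000 t001 t010 t011 t100 t101 t110 t111 : ℕ) → Bool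
  | [], _, _, _, _, _, _, _, _ => true
  | v :: vs, t000, t001, t010, t011, t100, t101, t110, t111 =>
      Nat.beq (t111 % 2 ^ (v + 1)) (2 ^ v - 1) &&
        checkTerms vs t001 t011 t101 t111
          (Nat.lor t001 (Nat.shiftLeft t000 v)) (Nat.lor t011 (Nat.shiftLeft t010 v))
          (Nat.lor t101 (Nat.shiftLeft t100 v)) (Nat.lor t111 (Nat.shiftLeft t110 v))

theorem IsSlidSeq.eq_of_checkTerms {a : ℕ → ℕ} (ha : IsSlidSeq {3} a) (vs : List ℕ) (n : ℕ)
    (h : checkTerms vs (sumMask a n false false false) (sumMask a n false false true)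
      (sumMask a n false true false) (sumMask a n false true true)
      (sumMask a n true false false) (sumMask a n true false true)
      (sumMask a n true true false) (sumMask a n true true true) = true) :
    ∀ i (hi : i < vs.length), a (n + 1 + i) = vs[i] := by
  induction vs generalizing n with
  | nil => simp
  | cons v vs ih =>
    rw [checkTerms, Bool.and_eq_true] at h
    have hv : a (n + 1) = v := ha.eq_of_sumMask_mod (Nat.eq_of_beq_eq_true h.1)
    have hrest := ih (n + 1) (by subst hv; exact h.2)
    rintro (_ | i) hi
    · exact hv
    · rw [List.getElem_cons_succ, ← hrest i (by simpa using hi)]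
      congr 1
      omega

/-- The first 41 terms of the `{3}`-LID sequence. -/
def threeSlidTerms : List ℕ :=
  [1, 2, 4, 8, 9, 11, 15, 23, 32, 64, 79, 134, 166, 244, 355, 489, 679, 1011, 1485, 2163, 3141,
    4499, 6535, 8974, 13135, 19118, 25655, 38623, 56295, 81545, 118297, 169605, 246402, 354455,
    511413, 739024, 985979, 1481907, 2164309, 3148474, 4568516]

theorem checkTerms_threeSlidTerms : checkTerms threeSlidTerms 1 1 1 1 1 1 1 1 = true := by
  decide +kernel

theorem three_slid_recurrence_indices
    (a : ℕ → ℕ) (ha : IsSlidSeq {3} a)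
    (n : ℕ) (h1 : 4 ≤ n) (h2 : n ≤ 40) :
    a (n + 1) = a n + a (n - 3) ↔
      n ∈ ({4, 5, 6, 7, 8, 10, 12, 15} : Finset ℕ) := by
  have hlen : threeSlidTerms.length = 41 := rfl
  have hterm (k : ℕ) (hk : 1 ≤ k) (hk' : k ≤ 41) : a k = threeSlidTerms.getD (k - 1) 0 := by
    have hi : k - 1 < threeSlidTerms.length := by omega
    have := ha.eq_of_checkTerms threeSlidTerms 0 checkTerms_threeSlidTerms (k - 1) hi
    rw [show 0 + 1 + (k - 1) = k by omega] at this
    rw [this, List.getD_eq_getElem _ _ hi]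
  rw [hterm (n + 1) (by omega) (by omega), hterm n (by omega) (by omega),
    hterm (n - 3) (by omega) (by omega)]
  clear hterm hlen ha
  interval_cases n <;> decide
end

section
/- Suppose there exists a positive integer d such that: k ≥ 2d − 4c + 2; C_d(n) holds for all c + d + 1 ≤ n ≤ k + c + 1 + d; and B(n) holds for all k + c + 1 ≤ n ≤ 2k + c + d + 2. Then a_{n+1} = a_n + a_{n−k} for all integers n > k + c. -/
/-- Strong induction on the integers above a bound. -/
lemma int_strong_induction_above {P : ℤ → Prop} (b : ℤ)
    (h : ∀ n, b ≤ n → (∀ m, b ≤ m → m < n → P m) → P n) : ∀ n, b ≤ n → P n := by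
  have key : ∀ t : ℕ, ∀ n, b ≤ n → n < b + t → P n := by
    intro t
    induction t with
    | zero => intro n h1 h2; push_cast at h2; omega
    | succ t ih =>
      intro n h1 h2
      push_cast at h2
      exact h n h1 fun m hm hmn => ih m hm (by omega)
  intro n hn
  exact key (n - b + 1).toNat n hn (by omega)

/-- An integer-indexed sequence `A` obeying the a priori bounds of an `S`-LID sequence up to index
`k + c + 1` and the recurrence beyond it, where `p = k - c` is the least positive integer outside
`S`, and `T` is the sum of `A` along steps of length `p`. -/
structure SlidModel (k c p : ℤ) (A T : ℤ → ℤ) : Prop where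
  c_pos : 1 ≤ c
  p_pos : 1 ≤ p
  k_eq : k = p + c
  A_nonpos : ∀ n ≤ 0, A n = 0
  T_nonpos : ∀ n ≤ 0, T n = 0
  T_step : ∀ n, T n = A n + T (n - p)
  recurrence : ∀ n, k + c < n → A (n + 1) = A n + A (n - k)
  superadd : ∀ n, A n + A (n - k) ≤ A (n + 1)
  step_pos : ∀ n, 0 ≤ n → A n < A (n + 1)
  upper : ∀ n, 0 ≤ n → n ≤ k + c → A (n + 1) ≤ T n + 1
  ne_pair : ∀ i n, 1 ≤ i → i + p < n → n ≤ k + c + 1 → A n ≠ A i + A (i + p)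

namespace SlidModel

variable {k c p : ℤ} {A T : ℤ → ℤ}

lemma A_mono (h : SlidModel k c p A T) : Monotone A := by
  refine monotone_int_of_le_succ fun n => ?_
  rcases le_or_gt 0 n with hn | hn
  · exact (h.step_pos n hn).le
  · rw [h.A_nonpos n hn.le, h.A_nonpos (n + 1) hn]

lemma A_nonneg (h : SlidModel k c p A T) (n : ℤ) : 0 ≤ A n := by
  rcases le_or_gt n 0 with hn | hn
  · exact (h.A_nonpos n hn).ge
  · exact (h.A_nonpos 0 le_rfl).ge.trans (h.A_mono hn.le)

lemma self_le (h : SlidModel k c p A T) : ∀ n, 0 ≤ n → n ≤ A n := by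
  refine int_strong_induction_above 0 fun n hn ih => ?_
  rcases hn.eq_or_lt with rfl | hn
  · exact h.A_nonneg 0
  · have h1 := ih (n - 1) (by omega) (by omega)
    have h2 := h.step_pos (n - 1) (by omega)
    rw [sub_add_cancel] at h2
    omega

lemma T_mono (h : SlidModel k c p A T) : Monotone T := by
  have hp := h.p_pos
  have key : ∀ n, 0 ≤ n → T n ≤ T (n + 1) := by
    refine int_strong_induction_above 0 fun n hn ih => ?_
    have h1 : T (n - p) ≤ T (n + 1 - p) := by
      rcases le_or_gt 0 (n - p) with h0 | h0
      · have := ih (n - p) h0 (by omega)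
        rwa [show n - p + 1 = n + 1 - p by ring] at this
      · rw [h.T_nonpos _ h0.le, h.T_nonpos (n + 1 - p) (by omega)]
    have h2 := h.A_mono (show n ≤ n + 1 by omega)
    rw [h.T_step n, h.T_step (n + 1)]
    omega
  refine monotone_int_of_le_succ fun n => ?_
  rcases le_or_gt 0 n with hn | hn
  · exact key n hn
  · rw [h.T_nonpos n hn.le, h.T_nonpos (n + 1) hn]

lemma T_nonneg (h : SlidModel k c p A T) (n : ℤ) : 0 ≤ T n := by
  rcases le_or_gt n 0 with hn | hn
  · exact (h.T_nonpos n hn).ge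
  · exact (h.T_nonpos 0 le_rfl).ge.trans (h.T_mono hn.le)

lemma T_eq_A (h : SlidModel k c p A T) {n : ℤ} (hn : n ≤ p) : T n = A n := by
  rw [h.T_step, h.T_nonpos (n - p) (by omega), add_zero]

lemma A_eq_self (h : SlidModel k c p A T) : ∀ n, 0 ≤ n → n ≤ p + 1 → A n = n := by
  have hk := h.k_eq
  have hc := h.c_pos
  refine int_strong_induction_above (P := fun n => n ≤ p + 1 → A n = n) 0 fun n hn ih hle => ?_
  rcases hn.eq_or_lt with rfl | hn
  · exact h.A_nonpos 0 le_rfl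
  · have h1 := ih (n - 1) (by omega) (by omega) (by omega)
    have h2 := h.upper (n - 1) (by omega) (by omega)
    rw [sub_add_cancel, h.T_eq_A (by omega), h1] at h2
    have := h.self_le n hn.le
    omega

lemma T_eq_self (h : SlidModel k c p A T) {n : ℤ} (h0 : 0 ≤ n) (hn : n ≤ p) : T n = n := by
  rw [h.T_eq_A hn, h.A_eq_self n h0 (by omega)]

lemma A_add_two (h : SlidModel k c p A T) : A (p + 2) = p + 3 := by
  have hk := h.k_eq
  have hc := h.c_pos
  have hp := h.p_pos
  have h1 := h.upper (p + 1) (by omega) (by omega)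
  rw [h.T_step (p + 1), h.A_eq_self (p + 1) (by omega) le_rfl,
    h.T_eq_self (n := p + 1 - p) (by omega) (by omega), show p + 1 + 1 = p + 2 by ring] at h1
  have h2 := h.ne_pair 1 (p + 2) le_rfl (by omega) (by omega)
  rw [add_comm 1 p, h.A_eq_self (p + 1) (by omega) le_rfl,
    h.A_eq_self 1 (by omega) (by omega)] at h2
  have h3 := h.self_le (p + 2) (by omega)
  omega

lemma step_le (h : SlidModel k c p A T) {n : ℤ} (h1 : p ≤ n) (h2 : n ≤ k + c) (h3 : n ≤ 2 * p) :
    A (n + 1) ≤ A n + (n - p) + 1 := by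
  have hk := h.k_eq
  have hc := h.c_pos
  have hu := h.upper n (by omega) (by omega)
  rw [h.T_step, h.T_eq_self (n := n - p) (by omega) (by omega)] at hu
  omega

lemma T_two_le (h : SlidModel k c p A T) (n : ℤ) : A n + A (n - p) ≤ T n := by
  rw [h.T_step n, h.T_step (n - p)]
  linarith [h.T_nonneg (n - p - p)]

/-- The two forms of the gap inequality. -/
lemma gap_iff (h : SlidModel k c p A T) {n : ℤ} (hn : c + 1 ≤ n) :
    T (n + k) < A (n + k + 1) + A (n + 1) ↔ T (n + c) < A n + A (n + 1) := by
  have hk := h.k_eq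
  have h1 := h.recurrence (n + k) (by omega)
  have h2 := h.T_step (n + k)
  rw [add_sub_cancel_right] at h1
  rw [show n + k - p = n + c by omega] at h2
  omega

/-- The conclusion under the gap inequality `C_d` when `d ≤ k - 2c - 2`. -/
lemma gap_of_small_d (h : SlidModel k c p A T) {d : ℤ} (hd : 1 ≤ d) (hd2 : d ≤ k - 2 * c - 2)
    (hC : ∀ n, c + d + 1 ≤ n → n ≤ k + c + 1 + d → A (n + c) + A (n - d) < A (n + 1) + A n)
    (hB : T (k + c) < A (k + c + 1) + A (c + 1))
    (hE : ∀ n, c + 1 ≤ n → n ≤ k + c + d + 1 → T (n + c) < A n + A (n + 1)) :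
    ∀ n, c + 1 ≤ n → T (n + c) < A n + A (n + 1) := by
  have hk := h.k_eq
  have hc := h.c_pos
  have hC' : ∀ n, c + d + 1 ≤ n → A (n + c) + A (n - d) < A (n + 1) + A n := by
    refine int_strong_induction_above _ fun n hn ih => ?_
    rcases le_or_gt n (k + c + 1 + d) with hle | hlt
    · exact hC n hn hle
    · have i1 := ih (n - 1) (by omega) (by omega)
      have i2 := ih (n - 1 - k) (by omega) (by omega)
      have r1 := h.recurrence (n - 1 + c) (by omega)
      have r2 := h.recurrence (n - 1 - d) (by omega)
      have r3 := h.recurrence n (by omega)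
      have r4 := h.recurrence (n - 1) (by omega)
      rw [show n - 1 + c + 1 = n + c by ring, show n - 1 + c - k = n - 1 - k + c by ring] at r1
      rw [show n - 1 - d + 1 = n - d by ring, show n - 1 - d - k = n - 1 - k - d by ring] at r2
      rw [show n - k = n - 1 - k + 1 by ring] at r3
      rw [sub_add_cancel] at r4 i1
      omega
  refine int_strong_induction_above _ fun n hn ih => ?_
  rcases le_or_gt n (k + c + d + 1) with hle | hlt
  · exact hE n hn hle
  · have hT : T (n - d - 2) < A (n - d) := by
      have r := h.recurrence (n - d - 1) (by omega)
      rw [show n - d - 1 + 1 = n - d by ring] at r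
      rcases eq_or_lt_of_le (show k + c + 2 ≤ n - d - 0 by omega) with he | hl
      · rw [show n - d - 2 = k + c by omega, r, show n - d - 1 = k + c + 1 by omega,
          show k + c + 1 - k = c + 1 by ring]
        exact hB
      · have i := (h.gap_iff (n := n - d - 2 - k) (by omega)).2
          (ih (n - d - 2 - k) (by omega) (by omega))
        rw [show n - d - 2 - k + k = n - d - 2 by ring, show n - d - 2 - k + 1 = n - d - 1 - k by
          ring,
          show n - d - 2 + 1 = n - d - 1 by ring] at i
        omega
    have m := h.T_mono (show n + c - p ≤ n - d - 2 by omega)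
    have s := h.T_step (n + c)
    have cc := hC' n (by omega)
    omega

/-- Nonnegativity of the `C`-type gap for the critical shift `k - 2c - 2` along one window of length
`k + 1` propagates the gap inequality to all indices. -/
lemma gap_of_window (h : SlidModel k c p A T) {x w : ℤ} (hw1 : p - 1 ≤ w) (hw2 : c < w)
    (hwx : w ≤ x + 1) (hx : 2 * k - c ≤ x)
    (hE : ∀ n, c + 1 ≤ n → n ≤ x → T (n + c) < A n + A (n + 1))
    (hH : ∀ n, w ≤ n → n ≤ w + k → A (n + c) + A (n - (k - 2 * c - 2)) ≤ A n + A (n + 1)) :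
    ∀ n, c + 1 ≤ n → T (n + c) < A n + A (n + 1) := by
  have hk := h.k_eq
  have hc := h.c_pos
  have hp := h.p_pos
  have hH' : ∀ n, w ≤ n → A (n + c) + A (n - (k - 2 * c - 2)) ≤ A n + A (n + 1) := by
    refine int_strong_induction_above _ fun n hn ih => ?_
    rcases le_or_gt n (w + k) with hle | hlt
    · exact hH n hn hle
    · have i1 := ih (n - 1) (by omega) (by omega)
      have i2 := ih (n - 1 - k) (by omega) (by omega)
      have r1 := h.recurrence (n - 1 + c) (by omega)
      have r2 := h.recurrence (n - 1 - (k - 2 * c - 2)) (by omega)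
      have r3 := h.recurrence n (by omega)
      have r4 := h.recurrence (n - 1) (by omega)
      rw [show n - 1 + c + 1 = n + c by ring, show n - 1 + c - k = n - 1 - k + c by ring] at r1
      rw [show n - 1 - (k - 2 * c - 2) + 1 = n - (k - 2 * c - 2) by ring,
        show n - 1 - (k - 2 * c - 2) - k = n - 1 - k - (k - 2 * c - 2) by ring] at r2
      rw [show n - k = n - 1 - k + 1 by ring] at r3
      rw [sub_add_cancel] at r4 i1
      omega
  refine int_strong_induction_above _ fun n hn ih => ?_
  rcases le_or_gt n x with hle | hlt
  · exact hE n hn hle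
  · have i := ih (n - 2 * p) (by omega) (by omega)
    have t1 := h.T_step (n + c)
    have t2 := h.T_step (n + c - p)
    have r1 := h.recurrence (n + c - p) (by omega)
    have r2 := h.recurrence (n + c - p + 1) (by omega)
    have hh := hH' n (by omega)
    rw [show n + c - p - k = n - 2 * p by omega] at r1
    rw [show n + c - p + 1 + 1 = n - (k - 2 * c - 2) by omega,
      show n + c - p + 1 - k = n - 2 * p + 1 by omega] at r2
    rw [show n + c - p - p = n - 2 * p + c by ring] at t2
    omega

lemma sub_one_le_shift (h : SlidModel k c p A T) {n : ℤ} (h1 : p ≤ n + c) (h2 : n + c < 2 * p)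
    (hE : T (n + c) < A n + A (n + 1)) :
    A (n + c) + A (n - (k - 2 * c - 2)) ≤ A n + A (n + 1) + 1 := by
  have hk := h.k_eq
  have t := h.T_step (n + c)
  rw [h.T_eq_self (n := n + c - p) (by omega) (by omega)] at t
  rw [h.A_eq_self (n - (k - 2 * c - 2)) (by omega) (by omega)]
  omega

lemma A_add_three_le (h : SlidModel k c p A T) (hc2 : 2 ≤ c) (hcp : c < p) : A (p + 3) ≤ p + 6 := by
  have hk := h.k_eq
  have s := h.step_le (n := p + 2) (by omega) (by omega) (by omega)
  rw [h.A_add_two, show p + 2 + 1 = p + 3 by ring] at s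
  omega

lemma initial_bounds (h : SlidModel k c p A T) (hc2 : 2 ≤ c) (hcp : c < p)
    (hE : ∀ n, c + 1 ≤ n → n ≤ 2 * k - c → T (n + c) < A n + A (n + 1)) :
    A (k + 1) ≤ 2 * p + 2 - c ∧ A (k + 2) ≤ 2 * p + 6 - c ∧
      A (k + c + 1) + 2 * c + 2 ≤ A (k + 1) + A (k + 2) := by
  have hk := h.k_eq
  have e1 := hE (p + 1) (by omega) (by omega)
  have e2 := hE (p + 2) (by omega) (by omega)
  have e3 := hE (k + 1) (by omega) (by omega)
  have t1 := h.T_two_le (p + 1 + c)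
  have t2 := h.T_two_le (p + 2 + c)
  have t3 := h.T_two_le (k + 1 + c)
  have a3 := h.A_add_three_le hc2 hcp
  have s := h.self_le (k + 1 + c - p) (by omega)
  rw [h.A_eq_self (p + 1 + c - p) (by omega) (by omega), show p + 1 + c = k + 1 by omega] at t1
  rw [h.A_eq_self (p + 2 + c - p) (by omega) (by omega), show p + 2 + c = k + 2 by omega] at t2
  rw [show k + 1 + c = k + c + 1 by ring] at t3 e3 s
  rw [show p + 1 + c = k + 1 by omega, show p + 1 + 1 = p + 2 by ring, h.A_add_two,
    h.A_eq_self (p + 1) (by omega) le_rfl] at e1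
  rw [show p + 2 + c = k + 2 by omega, show p + 2 + 1 = p + 3 by ring, h.A_add_two] at e2
  rw [show k + 1 + 1 = k + 2 by ring] at e3
  omega

/-- The gap inequality up to `2k - c` forces `p` to be quadratically large in `c`. -/
lemma quadratic_le (h : SlidModel k c p A T) (hc2 : 2 ≤ c) (hcp : c < p)
    (hE : ∀ n, c + 1 ≤ n → n ≤ 2 * k - c → T (n + c) < A n + A (n + 1)) :
    3 * c ^ 2 + 13 * c ≤ 8 * p + 10 := by
  have hk := h.k_eq
  obtain ⟨b1, b2, b3⟩ := h.initial_bounds hc2 hcp hE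
  have e := hE (k + c + 1) (by omega) (by omega)
  have t := h.T_two_le (k + c + 1 + c)
  have s := h.self_le (k + c + 1 + c - p) (by omega)
  have r := h.recurrence (k + c + 1) (by omega)
  rw [show k + c + 1 - k = c + 1 by ring, h.A_eq_self (c + 1) (by omega) (by omega)] at r
  have grow : ∀ j : ℕ, 2 * A (k + c + 1) + 2 * c * j + j * (j + 1) ≤ 2 * A (k + c + 1 + j) := by
    intro j
    induction j with
    | zero => simp
    | succ j ih =>
      have r := h.recurrence (k + c + 1 + j) (by omega)
      have s := h.self_le (k + c + 1 + j - k) (by omega)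
      push_cast
      rw [← add_assoc, r]
      linarith
  have g := grow c.toNat
  rw [Int.toNat_of_nonneg (by omega)] at g
  nlinarith

/-- The gap inequality up to `2k - c` propagates when `3c + 3 ≤ p`. -/
lemma gap_of_three_mul_lt (h : SlidModel k c p A T) (hcp : 3 * c + 3 ≤ p)
    (hE : ∀ n, c + 1 ≤ n → n ≤ 2 * k - c → T (n + c) < A n + A (n + 1)) :
    ∀ n, c + 1 ≤ n → T (n + c) < A n + A (n + 1) := by
  have hk := h.k_eq
  have hc := h.c_pos
  obtain ⟨H, hH⟩ : ∃ H : ℤ → ℤ,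
      ∀ n, H n = A n + A (n + 1) - A (n + c) - A (n - (k - 2 * c - 2)) := ⟨_, fun _ => rfl⟩
  have low : ∀ n, p - c ≤ n → n ≤ k + c + 1 → -1 ≤ H n := fun n h1 h2 => by
    have := h.sub_one_le_shift (n := n) (by omega) (by omega) (hE n (by omega) (by omega))
    rw [hH]; omega
  -- the increments of `H` along `k + x`
  have incr : ∀ x, c + 1 ≤ x → H (k + x + 1) = H (k + x) + (A x + A (x + 1) - A (x + c))
      - (A (x + 2 * c + 3) - A (x + 2 * c + 2)) := fun x hx => by
    have r1 := h.recurrence (k + x) (by omega)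
    have r2 := h.recurrence (k + x + 1) (by omega)
    have r3 := h.recurrence (k + x + c) (by omega)
    rw [show k + x - k = x by ring] at r1
    rw [show k + x + 1 - k = x + 1 by ring] at r2
    rw [show k + x + c - k = x + c by ring] at r3
    rw [hH, hH, show k + x - (k - 2 * c - 2) = x + 2 * c + 2 by ring,
      show k + x + 1 - (k - 2 * c - 2) = x + 2 * c + 3 by ring,
      show k + x + 1 + c = k + x + c + 1 by ring]
    omega
  have early : ∀ x, c + 1 ≤ x → x ≤ p - c - 2 → H (k + x) + 1 ≤ H (k + x + 1) := fun x h1 h2 => by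
    have i := incr x h1
    rw [h.A_eq_self x (by omega) (by omega), h.A_eq_self (x + 1) (by omega) (by omega),
      h.A_eq_self (x + c) (by omega) (by omega)] at i
    rcases le_or_gt (x + 2 * c + 3) (p + 1) with hs | hs
    · rw [h.A_eq_self (x + 2 * c + 3) (by omega) (by omega),
        h.A_eq_self (x + 2 * c + 2) (by omega) (by omega)] at i
      omega
    · have s := h.step_le (n := x + 2 * c + 2) (by omega) (by omega) (by omega)
      rw [show x + 2 * c + 2 + 1 = x + 2 * c + 3 by ring] at s
      omega
  have start : ∀ x, c + 1 ≤ x → x ≤ p - c - 1 → x - c - 2 ≤ H (k + x) := by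
    refine int_strong_induction_above (P := fun x => x ≤ p - c - 1 → x - c - 2 ≤ H (k + x)) _
      fun x h1 ih h2 => ?_
    rcases h1.eq_or_lt with rfl | h1
    · have := low (k + (c + 1)) (by omega) (by omega)
      omega
    · have i := ih (x - 1) (by omega) (by omega) (by omega)
      have e := early (x - 1) (by omega) (by omega)
      rw [show k + (x - 1) + 1 = k + x by ring] at e
      omega
  have late : ∀ x, p - 1 ≤ x → H (k + x + 1) = H (k + x) + H x := fun x hx => by
    have i := incr x (by omega)
    have r := h.recurrence (x + 2 * c + 2) (by omega)
    rw [show x + 2 * c + 2 + 1 = x + 2 * c + 3 by ring,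
      show x + 2 * c + 2 - k = x - (k - 2 * c - 2) by ring] at r
    rw [i, hH x]; omega
  have middle : ∀ x, p - c - 1 ≤ x → x ≤ p - 2 → H (k + x + 1) = H (k + x) + H x +
      (x - (p - c - 2)) - (A (x + 2 * c + 3) - A (x + 2 * c + 2)) := fun x h1 h2 => by
    have i := incr x (by omega)
    have a := h.A_eq_self (x - (k - 2 * c - 2)) (by omega) (by omega)
    rw [i, hH x]; omega
  have loss : ∀ x, p - c - 1 ≤ x → H (k + x) + H x - (c + 1) ≤ H (k + x + 1) := fun x h1 => by
    rcases le_or_gt (p - 1) x with hx | hx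
    · rw [late x hx]; omega
    · have s := h.step_le (n := x + 2 * c + 2) (by omega) (by omega) (by omega)
      rw [show x + 2 * c + 2 + 1 = x + 2 * c + 3 by ring] at s
      rw [middle x h1 (by omega)]; omega
  -- the first four values of `H` beyond `p - c - 2`
  have val : ∀ x, x ≤ p + 1 - c → p - c - 1 ≤ x → H x = p - 2 * c - 1 := fun x h1 h2 => by
    rw [hH, h.A_eq_self x (by omega) (by omega), h.A_eq_self (x + 1) (by omega) (by omega),
      h.A_eq_self (x + c) (by omega) (by omega), h.A_eq_self _ (by omega) (by omega)]
    omega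
  have val3 : p - 2 * c - 2 ≤ H (p - c + 2) := by
    have a := h.self_le (p - c + 2 + 1) (by omega)
    rw [hH, h.A_eq_self (p - c + 2) (by omega) (by omega),
      h.A_eq_self (p - c + 2 - (k - 2 * c - 2)) (by omega) (by omega),
      show p - c + 2 + c = p + 2 by ring, h.A_add_two]
    omega
  obtain ⟨F, hF⟩ : ∃ F : ℤ → ℤ, ∀ j, F j = H (k + (p - c - 1 + j)) := ⟨_, fun _ => rfl⟩
  have F0 : p - 2 * c - 3 ≤ F 0 := by
    have := start (p - c - 1) (by omega) (by omega)
    rw [hF, add_zero]; omega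
  have Floss : ∀ j, 0 ≤ j → F j + H (p - c - 1 + j) - (c + 1) ≤ F (j + 1) := fun j hj => by
    have := loss (p - c - 1 + j) (by omega)
    rwa [add_assoc, add_assoc, ← hF, ← hF] at this
  have Flate : ∀ j, c ≤ j → F (j + 1) = F j + H (p - c - 1 + j) := fun j hj => by
    have := late (p - c - 1 + j) (by omega)
    rwa [add_assoc, add_assoc, ← hF, ← hF] at this
  have h0 := val (p - c - 1 + 0) (by omega) (by omega)
  have h1 := val (p - c - 1 + 1) (by omega) (by omega)
  have h2 := val (p - c - 1 + 2) (by omega) (by omega)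
  have h3 : p - 2 * c - 2 ≤ H (p - c - 1 + 3) := by
    rwa [show p - c - 1 + 3 = p - c + 2 by ring]
  have l0 := Floss 0 le_rfl
  have l1 := Floss 1 (by omega)
  have l2 := Floss 2 (by omega)
  have l3 := Floss 3 (by omega)
  norm_num at l0 l1 l2 l3 h0 h1
  have down : ∀ m, c ≤ m → 4 ≤ m → 3 * c + 3 - m ≤ F m →
      ∀ j, m ≤ j → j ≤ 3 * c + 3 → 3 * c + 3 - j ≤ F j := fun m hm hm4 hFm => by
    refine int_strong_induction_above (P := fun j => j ≤ 3 * c + 3 → 3 * c + 3 - j ≤ F j) _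
      fun j h1 ih h2 => ?_
    rcases h1.eq_or_lt with rfl | h1
    · exact hFm
    · have i := ih (j - 1) (by omega) (by omega) (by omega)
      have f := Flate (j - 1) (by omega)
      have l := low (p - c - 1 + (j - 1)) (by omega) (by omega)
      rw [sub_add_cancel] at f
      omega
  have upto : ∀ j, 1 ≤ j → j ≤ 3 * c + 3 → 0 ≤ F j := by
    intro j hj1 hj2
    rcases le_or_gt j 4 with hj4 | hj4
    · interval_cases j <;> omega
    · rcases le_or_gt 4 c with hc4 | hc4
      · have hcum : ∀ i, 4 ≤ i → i ≤ c →
            5 * (p - 2 * c) + 2 + 4 * (i - 4) + A (k + 1) ≤ F i + A (k + 1 + i) := by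
          have Fmid : ∀ j, 0 ≤ j → j < c → F (j + 1) + A (k + 1 + (j + 1)) =
              F j + A (k + 1 + j) + H (p - c - 1 + j) + (j + 1) := fun j h1 h2 => by
            have := middle (p - c - 1 + j) (by omega) (by omega)
            rw [add_assoc, add_assoc, ← hF, ← hF,
              show p - c - 1 + j + 2 * c + 3 = k + 1 + (j + 1) by omega,
              show p - c - 1 + j + 2 * c + 2 = k + 1 + j by omega] at this
            omega
          have m0 := Fmid 0 (by omega) (by omega)
          have m1 := Fmid 1 (by omega) (by omega)
          have m2 := Fmid 2 (by omega) (by omega)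
          have m3 := Fmid 3 (by omega) (by omega)
          norm_num at m0 m1 m2 m3
          refine int_strong_induction_above (P := fun i => i ≤ c →
            5 * (p - 2 * c) + 2 + 4 * (i - 4) + A (k + 1) ≤ F i + A (k + 1 + i)) _
            fun i h1 ih h2 => ?_
          rcases h1.eq_or_lt with rfl | h1
          · omega
          · have i1 := ih (i - 1) (by omega) (by omega) (by omega)
            have f := Fmid (i - 1) (by omega) (by omega)
            have l := low (p - c - 1 + (i - 1)) (by omega) (by omega)
            rw [sub_add_cancel] at f
            omega
        obtain ⟨-, b2, b3⟩ := h.initial_bounds (by omega) (by omega) hE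
        rcases le_or_gt j c with hjc | hjc
        · have g := hcum j (by omega) hjc
          have m := h.A_mono (show k + 1 + j ≤ k + c + 1 by omega)
          omega
        · have g := hcum c hc4 le_rfl
          rw [show k + 1 + c = k + c + 1 by ring] at g
          have := down c le_rfl hc4 (by omega) j hjc.le hj2
          omega
      · have := down 4 (by omega) le_rfl (by
          have f1 := Flate 1
          have f2 := Flate 2
          have f3 := Flate 3
          norm_num at f1 f2 f3 h1
          interval_cases c <;> omega) j hj4.le hj2
        omega
  have after : ∀ j, 3 * c + 3 ≤ j → j ≤ k + 1 → 0 ≤ F j := by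
    refine int_strong_induction_above (P := fun j => j ≤ k + 1 → 0 ≤ F j) _
      fun j h1 ih h2 => ?_
    rcases h1.eq_or_lt with rfl | h1
    · exact upto _ (by omega) le_rfl
    · have i := ih (j - 1) (by omega) (by omega) (by omega)
      have f := Flate (j - 1) (by omega)
      have s := start (p - c - 1 + (j - 1) - k) (by omega) (by omega)
      rw [add_sub_cancel] at s
      rw [sub_add_cancel] at f
      omega
  refine h.gap_of_window (w := k + p - c) (x := 2 * k - c) (by omega) (by omega) (by omega) le_rfl
    hE
    fun n hn1 hn2 => ?_
  have hn : 0 ≤ F (n - (k + p - c - 1)) := by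
    rcases le_or_gt (n - (k + p - c - 1)) (3 * c + 3) with hle | hlt
    · exact upto _ (by omega) hle
    · exact after _ hlt.le (by omega)
  rw [hF, show k + (p - c - 1 + (n - (k + p - c - 1))) = n by ring, hH] at hn
  omega

lemma add_four_lt (h : SlidModel k c p A T) {n : ℤ} (hE : T (n + c) < A n + A (n + 1)) :
    A (n + c) + A (n + c - p) + A (n + c - 2 * p) + A (n + c - 3 * p) < A n + A (n + 1) := by
  rw [h.T_step (n + c), h.T_step (n + c - p), h.T_step (n + c - p - p),
    h.T_step (n + c - p - p - p), show n + c - p - p = n + c - 2 * p by ring,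
    show n + c - 2 * p - p = n + c - 3 * p by ring] at hE
  linarith [h.T_nonneg (n + c - 3 * p - p)]

lemma lt_of_add_four_lt (h : SlidModel k c p A T) {n : ℤ} (hn : n + c ≤ 4 * p)
    (hA : A (n + c) + A (n + c - p) + A (n + c - 2 * p) + A (n + c - 3 * p) < A n + A (n + 1)) :
    T (n + c) < A n + A (n + 1) := by
  rwa [h.T_step (n + c), h.T_step (n + c - p), h.T_step (n + c - p - p),
    h.T_step (n + c - p - p - p), h.T_nonpos (n + c - p - p - p - p) (by omega), add_zero,
    show n + c - p - p = n + c - 2 * p by ring,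
    show n + c - 2 * p - p = n + c - 3 * p by ring, ← add_assoc, ← add_assoc]

lemma recurrence_sub_one (h : SlidModel k c p A T) :
    ∀ n, k + c + 1 < n → A n = A (n - 1) + A (n - 1 - k) := fun n hn => by
  have r := h.recurrence (n - 1) (by omega)
  rwa [sub_add_cancel] at r

lemma not_gap_six_two (h : SlidModel 6 2 4 A T)
    (hE : ∀ n, 3 ≤ n → n ≤ 10 → T (n + 2) < A n + A (n + 1)) : False := by
  have t := h.A_add_two
  have s6 := h.step_pos 6 (by norm_num)
  have s7 := h.superadd 7
  have s8 := h.superadd 8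
  have e10 := h.add_four_lt (hE 10 (by norm_num) (by norm_num))
  have u8 := h.step_le (n := 8) (by norm_num) (by norm_num) (by norm_num)
  norm_num [h.recurrence_sub_one, h.A_nonpos, h.A_eq_self] at t s6 s7 s8 e10 u8
  omega

lemma not_gap_ten_three (h : SlidModel 10 3 7 A T)
    (hE : ∀ n, 4 ≤ n → n ≤ 17 → T (n + 3) < A n + A (n + 1)) : False := by
  have t := h.A_add_two
  have s9 := h.step_pos 9 (by norm_num)
  have s10 := h.step_pos 10 (by norm_num)
  have s11 := h.superadd 11
  have s12 := h.superadd 12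
  have s13 := h.superadd 13
  have e17 := h.add_four_lt (hE 17 (by norm_num) (by norm_num))
  have u13 := h.step_le (n := 13) (by norm_num) (by norm_num) (by norm_num)
  norm_num [h.recurrence_sub_one, h.A_nonpos, h.A_eq_self] at t s9 s10 s11 s12 s13 e17 u13
  omega

lemma not_gap_eleven_three (h : SlidModel 11 3 8 A T)
    (hE : ∀ n, 4 ≤ n → n ≤ 19 → T (n + 3) < A n + A (n + 1)) : False := by
  have t := h.A_add_two
  have s10 := h.step_pos 10 (by norm_num)
  have s11 := h.step_pos 11 (by norm_num)
  have s12 := h.superadd 12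
  have s13 := h.superadd 13
  have s14 := h.superadd 14
  have e9 := h.add_four_lt (hE 9 (by norm_num) (by norm_num))
  have e12 := h.add_four_lt (hE 12 (by norm_num) (by norm_num))
  have e18 := h.add_four_lt (hE 18 (by norm_num) (by norm_num))
  norm_num [h.recurrence_sub_one, h.A_nonpos, h.A_eq_self] at t s10 s11 s12 s13 s14 e9 e12 e18
  omega

lemma not_gap_three_one (h : SlidModel 3 1 2 A T)
    (hE : ∀ n, 2 ≤ n → n ≤ 6 → T (n + 1) < A n + A (n + 1)) : False := by
  have t := h.A_add_two
  have s4 := h.superadd 4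
  have e6 := h.add_four_lt (hE 6 (by norm_num) (by norm_num))
  norm_num [h.recurrence_sub_one, h.A_nonpos, h.A_eq_self] at t s4 e6
  omega

lemma not_gap_seven_two (h : SlidModel 7 2 5 A T)
    (hE : ∀ n, 3 ≤ n → n ≤ 13 → T (n + 2) < A n + A (n + 1)) : False := by
  have t := h.A_add_two
  have s7 := h.step_pos 7 (by norm_num)
  have s8 := h.superadd 8
  have s9 := h.superadd 9
  have e13 := h.add_four_lt (hE 13 (by norm_num) (by norm_num))
  norm_num [h.recurrence_sub_one, h.A_nonpos, h.A_eq_self] at t s7 s8 s9 e13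
  omega

lemma not_gap_seven_two_of_C (h : SlidModel 7 2 5 A T)
    (hC : ∀ n, 5 ≤ n → n ≤ 12 → A (n + 2) + A (n - 2) < A (n + 1) + A n) : False := by
  have t := h.A_add_two
  have s7 := h.step_pos 7 (by norm_num)
  have s8 := h.superadd 8
  have s9 := h.superadd 9
  have c6 := hC 6 (by norm_num) (by norm_num)
  have c8 := hC 8 (by norm_num) (by norm_num)
  have c11 := hC 11 (by norm_num) (by norm_num)
  norm_num [h.recurrence_sub_one, h.A_nonpos, h.A_eq_self] at t s7 s8 s9 c6 c8 c11
  omega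

lemma gap_four_one (h : SlidModel 4 1 3 A T)
    (hE : ∀ n, 2 ≤ n → n ≤ 7 → T (n + 1) < A n + A (n + 1)) :
    ∀ n, 2 ≤ n → T (n + 1) < A n + A (n + 1) := by
  have t := h.A_add_two
  have s5 := h.superadd 5
  norm_num [h.recurrence_sub_one, h.A_nonpos, h.A_eq_self] at t s5
  refine h.gap_of_window (w := 2) (x := 7) (by norm_num) (by norm_num) (by norm_num)
    (by norm_num) hE fun n h1 h2 => ?_
  norm_num at h1 h2
  interval_cases n <;> norm_num [h.recurrence_sub_one, h.A_nonpos, h.A_eq_self] <;> linarith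

lemma gap_five_one (h : SlidModel 5 1 4 A T)
    (hE : ∀ n, 2 ≤ n → n ≤ 9 → T (n + 1) < A n + A (n + 1)) :
    ∀ n, 2 ≤ n → T (n + 1) < A n + A (n + 1) := by
  have t := h.A_add_two
  have s6 := h.superadd 6
  norm_num [h.recurrence_sub_one, h.A_nonpos, h.A_eq_self] at t s6
  refine h.gap_of_window (w := 3) (x := 9) (by norm_num) (by norm_num) (by norm_num)
    (by norm_num) hE fun n h1 h2 => ?_
  norm_num at h1 h2
  interval_cases n <;> norm_num [h.recurrence_sub_one, h.A_nonpos, h.A_eq_self] <;> linarith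

lemma gap_six_one (h : SlidModel 6 1 5 A T)
    (hE : ∀ n, 2 ≤ n → n ≤ 11 → T (n + 1) < A n + A (n + 1)) :
    ∀ n, 2 ≤ n → T (n + 1) < A n + A (n + 1) := by
  have t := h.A_add_two
  have s7 := h.superadd 7
  norm_num [h.recurrence_sub_one, h.A_nonpos, h.A_eq_self] at t s7
  refine h.gap_of_window (w := 4) (x := 11) (by norm_num) (by norm_num) (by norm_num)
    (by norm_num) hE fun n h1 h2 => ?_
  norm_num at h1 h2
  interval_cases n <;> norm_num [h.recurrence_sub_one, h.A_nonpos, h.A_eq_self] <;> linarith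

lemma gap_eight_two (h : SlidModel 8 2 6 A T)
    (hE : ∀ n, 3 ≤ n → n ≤ 14 → T (n + 2) < A n + A (n + 1)) :
    ∀ n, 3 ≤ n → T (n + 2) < A n + A (n + 1) := by
  have t := h.A_add_two
  have s8 := h.step_pos 8 (by norm_num)
  have s9 := h.superadd 9
  have s10 := h.superadd 10
  have e7 := h.add_four_lt (hE 7 (by norm_num) (by norm_num))
  have e8 := h.add_four_lt (hE 8 (by norm_num) (by norm_num))
  have e9 := h.add_four_lt (hE 9 (by norm_num) (by norm_num))
  have u10 := h.step_le (n := 10) (by norm_num) (by norm_num) (by norm_num)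
  norm_num [h.recurrence_sub_one, h.A_nonpos, h.A_eq_self] at t s8 s9 s10 e7 e8 e9 u10
  refine h.gap_of_window (w := 12) (x := 14) (by norm_num) (by norm_num) (by norm_num)
    (by norm_num) hE fun n h1 h2 => ?_
  norm_num at h1 h2
  interval_cases n <;> norm_num [h.recurrence_sub_one, h.A_nonpos, h.A_eq_self] <;> linarith

lemma gap_nine_two (h : SlidModel 9 2 7 A T)
    (hE : ∀ n, 3 ≤ n → n ≤ 16 → T (n + 2) < A n + A (n + 1)) :
    ∀ n, 3 ≤ n → T (n + 2) < A n + A (n + 1) := by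
  have t := h.A_add_two
  have s9 := h.step_pos 9 (by norm_num)
  have s10 := h.superadd 10
  have s11 := h.superadd 11
  have u9 := h.step_le (n := 9) (by norm_num) (by norm_num) (by norm_num)
  have u10 := h.step_le (n := 10) (by norm_num) (by norm_num) (by norm_num)
  have u11 := h.step_le (n := 11) (by norm_num) (by norm_num) (by norm_num)
  norm_num [h.recurrence_sub_one, h.A_nonpos, h.A_eq_self] at t s9 s10 s11 u9 u10 u11
  refine h.gap_of_window (w := 11) (x := 16) (by norm_num) (by norm_num) (by norm_num)
    (by norm_num) hE fun n h1 h2 => ?_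
  norm_num at h1 h2
  interval_cases n <;> norm_num [h.recurrence_sub_one, h.A_nonpos, h.A_eq_self] <;> linarith

lemma gap_ten_two (h : SlidModel 10 2 8 A T)
    (hE : ∀ n, 3 ≤ n → n ≤ 18 → T (n + 2) < A n + A (n + 1)) :
    ∀ n, 3 ≤ n → T (n + 2) < A n + A (n + 1) := by
  have t := h.A_add_two
  have s10 := h.step_pos 10 (by norm_num)
  have s11 := h.superadd 11
  have s12 := h.superadd 12
  have u10 := h.step_le (n := 10) (by norm_num) (by norm_num) (by norm_num)
  have u11 := h.step_le (n := 11) (by norm_num) (by norm_num) (by norm_num)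
  have u12 := h.step_le (n := 12) (by norm_num) (by norm_num) (by norm_num)
  norm_num [h.recurrence_sub_one, h.A_nonpos, h.A_eq_self] at t s10 s11 s12 u10 u11 u12
  refine h.gap_of_window (w := 7) (x := 18) (by norm_num) (by norm_num) (by norm_num)
    (by norm_num) hE fun n h1 h2 => ?_
  norm_num at h1 h2
  interval_cases n <;> norm_num [h.recurrence_sub_one, h.A_nonpos, h.A_eq_self] <;> linarith

lemma gap_twelve_three (h : SlidModel 12 3 9 A T)
    (hE : ∀ n, 4 ≤ n → n ≤ 21 → T (n + 3) < A n + A (n + 1)) :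
    ∀ n, 4 ≤ n → T (n + 3) < A n + A (n + 1) := by
  have t := h.A_add_two
  have s11 := h.step_pos 11 (by norm_num)
  have s12 := h.step_pos 12 (by norm_num)
  have s13 := h.superadd 13
  have s14 := h.superadd 14
  have s15 := h.superadd 15
  have e9 := h.add_four_lt (hE 9 (by norm_num) (by norm_num))
  have e10 := h.add_four_lt (hE 10 (by norm_num) (by norm_num))
  have e11 := h.add_four_lt (hE 11 (by norm_num) (by norm_num))
  have e12 := h.add_four_lt (hE 12 (by norm_num) (by norm_num))
  have e13 := h.add_four_lt (hE 13 (by norm_num) (by norm_num))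
  have e14 := h.add_four_lt (hE 14 (by norm_num) (by norm_num))
  have e17 := h.add_four_lt (hE 17 (by norm_num) (by norm_num))
  have e18 := h.add_four_lt (hE 18 (by norm_num) (by norm_num))
  norm_num [h.recurrence_sub_one, h.A_nonpos, h.A_eq_self]
    at t s11 s12 s13 s14 s15 e9 e10 e11 e12 e13 e14 e17 e18
  have hE2 : ∀ n, 4 ≤ n → n ≤ 26 → T (n + 3) < A n + A (n + 1) := fun n h1 h2 => by
    rcases le_or_gt n 21 with h3 | h3
    · exact hE n h1 h3
    · refine h.lt_of_add_four_lt (by omega) ?_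
      interval_cases n <;> norm_num [h.recurrence_sub_one, h.A_nonpos, h.A_eq_self] <;> linarith
  refine h.gap_of_window (w := 27) (x := 26) (by norm_num) (by norm_num) (by norm_num)
    (by norm_num) hE2 fun n h1 h2 => ?_
  norm_num at h1 h2
  interval_cases n <;> norm_num [h.recurrence_sub_one, h.A_nonpos, h.A_eq_self] <;> linarith

lemma gap_thirteen_three (h : SlidModel 13 3 10 A T)
    (hE : ∀ n, 4 ≤ n → n ≤ 23 → T (n + 3) < A n + A (n + 1)) :
    ∀ n, 4 ≤ n → T (n + 3) < A n + A (n + 1) := by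
  have t := h.A_add_two
  have s12 := h.step_pos 12 (by norm_num)
  have s13 := h.step_pos 13 (by norm_num)
  have s14 := h.superadd 14
  have s15 := h.superadd 15
  have s16 := h.superadd 16
  have e11 := h.add_four_lt (hE 11 (by norm_num) (by norm_num))
  have e12 := h.add_four_lt (hE 12 (by norm_num) (by norm_num))
  have e13 := h.add_four_lt (hE 13 (by norm_num) (by norm_num))
  have e14 := h.add_four_lt (hE 14 (by norm_num) (by norm_num))
  have e15 := h.add_four_lt (hE 15 (by norm_num) (by norm_num))
  have e16 := h.add_four_lt (hE 16 (by norm_num) (by norm_num))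
  have u12 := h.step_le (n := 12) (by norm_num) (by norm_num) (by norm_num)
  have u16 := h.step_le (n := 16) (by norm_num) (by norm_num) (by norm_num)
  norm_num [h.recurrence_sub_one, h.A_nonpos, h.A_eq_self]
    at t s12 s13 s14 s15 s16 e11 e12 e13 e14 e15 e16 u12 u16
  refine h.gap_of_window (w := 21) (x := 23) (by norm_num) (by norm_num) (by norm_num)
    (by norm_num) hE fun n h1 h2 => ?_
  norm_num at h1 h2
  interval_cases n <;> norm_num [h.recurrence_sub_one, h.A_nonpos, h.A_eq_self] <;> linarith

lemma gap_fourteen_three (h : SlidModel 14 3 11 A T)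
    (hE : ∀ n, 4 ≤ n → n ≤ 25 → T (n + 3) < A n + A (n + 1)) :
    ∀ n, 4 ≤ n → T (n + 3) < A n + A (n + 1) := by
  have t := h.A_add_two
  have s13 := h.step_pos 13 (by norm_num)
  have s14 := h.step_pos 14 (by norm_num)
  have s15 := h.superadd 15
  have s16 := h.superadd 16
  have s17 := h.superadd 17
  have e12 := h.add_four_lt (hE 12 (by norm_num) (by norm_num))
  have e13 := h.add_four_lt (hE 13 (by norm_num) (by norm_num))
  have e14 := h.add_four_lt (hE 14 (by norm_num) (by norm_num))
  have e15 := h.add_four_lt (hE 15 (by norm_num) (by norm_num))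
  have e16 := h.add_four_lt (hE 16 (by norm_num) (by norm_num))
  have u13 := h.step_le (n := 13) (by norm_num) (by norm_num) (by norm_num)
  have u17 := h.step_le (n := 17) (by norm_num) (by norm_num) (by norm_num)
  norm_num [h.recurrence_sub_one, h.A_nonpos, h.A_eq_self]
    at t s13 s14 s15 s16 s17 e12 e13 e14 e15 e16 u13 u17
  refine h.gap_of_window (w := 20) (x := 25) (by norm_num) (by norm_num) (by norm_num)
    (by norm_num) hE fun n h1 h2 => ?_
  norm_num at h1 h2
  interval_cases n <;> norm_num [h.recurrence_sub_one, h.A_nonpos, h.A_eq_self] <;> linarith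

lemma gap_seventeen_four (h : SlidModel 17 4 13 A T)
    (hE : ∀ n, 5 ≤ n → n ≤ 30 → T (n + 4) < A n + A (n + 1)) :
    ∀ n, 5 ≤ n → T (n + 4) < A n + A (n + 1) := by
  have t := h.A_add_two
  have s15 := h.step_pos 15 (by norm_num)
  have s16 := h.step_pos 16 (by norm_num)
  have s17 := h.step_pos 17 (by norm_num)
  have s18 := h.superadd 18
  have s19 := h.superadd 19
  have s20 := h.superadd 20
  have s21 := h.superadd 21
  have e13 := h.add_four_lt (hE 13 (by norm_num) (by norm_num))
  have e14 := h.add_four_lt (hE 14 (by norm_num) (by norm_num))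
  have e15 := h.add_four_lt (hE 15 (by norm_num) (by norm_num))
  have e16 := h.add_four_lt (hE 16 (by norm_num) (by norm_num))
  have e17 := h.add_four_lt (hE 17 (by norm_num) (by norm_num))
  have e18 := h.add_four_lt (hE 18 (by norm_num) (by norm_num))
  have e19 := h.add_four_lt (hE 19 (by norm_num) (by norm_num))
  have e20 := h.add_four_lt (hE 20 (by norm_num) (by norm_num))
  have e21 := h.add_four_lt (hE 21 (by norm_num) (by norm_num))
  have u15 := h.step_le (n := 15) (by norm_num) (by norm_num) (by norm_num)
  norm_num [h.recurrence_sub_one, h.A_nonpos, h.A_eq_self]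
    at t s15 s16 s17 s18 s19 s20 s21 e13 e14 e15 e16 e17 e18 e19 e20 e21 u15
  refine h.gap_of_window (w := 28) (x := 30) (by norm_num) (by norm_num) (by norm_num)
    (by norm_num) hE fun n h1 h2 => ?_
  norm_num at h1 h2
  interval_cases n <;> norm_num [h.recurrence_sub_one, h.A_nonpos, h.A_eq_self] <;> linarith

lemma gap_eighteen_four (h : SlidModel 18 4 14 A T)
    (hE : ∀ n, 5 ≤ n → n ≤ 32 → T (n + 4) < A n + A (n + 1)) :
    ∀ n, 5 ≤ n → T (n + 4) < A n + A (n + 1) := by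
  have t := h.A_add_two
  have s16 := h.step_pos 16 (by norm_num)
  have s17 := h.step_pos 17 (by norm_num)
  have s18 := h.step_pos 18 (by norm_num)
  have s19 := h.superadd 19
  have s20 := h.superadd 20
  have s21 := h.superadd 21
  have s22 := h.superadd 22
  have e14 := h.add_four_lt (hE 14 (by norm_num) (by norm_num))
  have e15 := h.add_four_lt (hE 15 (by norm_num) (by norm_num))
  have e16 := h.add_four_lt (hE 16 (by norm_num) (by norm_num))
  have e17 := h.add_four_lt (hE 17 (by norm_num) (by norm_num))
  have e18 := h.add_four_lt (hE 18 (by norm_num) (by norm_num))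
  have e19 := h.add_four_lt (hE 19 (by norm_num) (by norm_num))
  have e20 := h.add_four_lt (hE 20 (by norm_num) (by norm_num))
  have e21 := h.add_four_lt (hE 21 (by norm_num) (by norm_num))
  have e22 := h.add_four_lt (hE 22 (by norm_num) (by norm_num))
  have u16 := h.step_le (n := 16) (by norm_num) (by norm_num) (by norm_num)
  have u17 := h.step_le (n := 17) (by norm_num) (by norm_num) (by norm_num)
  have u18 := h.step_le (n := 18) (by norm_num) (by norm_num) (by norm_num)
  norm_num [h.recurrence_sub_one, h.A_nonpos, h.A_eq_self]
    at t s16 s17 s18 s19 s20 s21 s22 e14 e15 e16 e17 e18 e19 e20 e21 e22 u16 u17 u18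
  refine h.gap_of_window (w := 30) (x := 32) (by norm_num) (by norm_num) (by norm_num)
    (by norm_num) hE fun n h1 h2 => ?_
  norm_num at h1 h2
  interval_cases n <;> norm_num [h.recurrence_sub_one, h.A_nonpos, h.A_eq_self] <;> linarith

lemma gap_twentytwo_five (h : SlidModel 22 5 17 A T)
    (hE : ∀ n, 6 ≤ n → n ≤ 39 → T (n + 5) < A n + A (n + 1)) :
    ∀ n, 6 ≤ n → T (n + 5) < A n + A (n + 1) := by
  have t := h.A_add_two
  have s19 := h.step_pos 19 (by norm_num)
  have s20 := h.step_pos 20 (by norm_num)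
  have s21 := h.step_pos 21 (by norm_num)
  have s22 := h.step_pos 22 (by norm_num)
  have s23 := h.superadd 23
  have s24 := h.superadd 24
  have s25 := h.superadd 25
  have s26 := h.superadd 26
  have s27 := h.superadd 27
  have e17 := h.add_four_lt (hE 17 (by norm_num) (by norm_num))
  have e18 := h.add_four_lt (hE 18 (by norm_num) (by norm_num))
  have e19 := h.add_four_lt (hE 19 (by norm_num) (by norm_num))
  have e20 := h.add_four_lt (hE 20 (by norm_num) (by norm_num))
  have e21 := h.add_four_lt (hE 21 (by norm_num) (by norm_num))
  have e22 := h.add_four_lt (hE 22 (by norm_num) (by norm_num))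
  have e23 := h.add_four_lt (hE 23 (by norm_num) (by norm_num))
  have e24 := h.add_four_lt (hE 24 (by norm_num) (by norm_num))
  have e25 := h.add_four_lt (hE 25 (by norm_num) (by norm_num))
  have e26 := h.add_four_lt (hE 26 (by norm_num) (by norm_num))
  have e27 := h.add_four_lt (hE 27 (by norm_num) (by norm_num))
  have u19 := h.step_le (n := 19) (by norm_num) (by norm_num) (by norm_num)
  have u20 := h.step_le (n := 20) (by norm_num) (by norm_num) (by norm_num)
  norm_num [h.recurrence_sub_one, h.A_nonpos, h.A_eq_self]
    at t s19 s20 s21 s22 s23 s24 s25 s26 s27 e17 e18 e19 e20 e21 e22 e23 e24 e25 e26 e27 u19 u20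
  refine h.gap_of_window (w := 36) (x := 39) (by norm_num) (by norm_num) (by norm_num)
    (by norm_num) hE fun n h1 h2 => ?_
  norm_num at h1 h2
  interval_cases n <;> norm_num [h.recurrence_sub_one, h.A_nonpos, h.A_eq_self] <;> linarith

lemma not_gap_sixteen_four (h : SlidModel 16 4 12 A T)
    (hd : A 15 ≤ 16 ∨ ∀ i n, 1 ≤ i → i + 12 + 1 < n → n ≤ 21 → A n ≠ A i + A (i + 12 + 1))
    (hE : ∀ n, 5 ≤ n → n ≤ 28 → T (n + 4) < A n + A (n + 1)) : False := by
  have n15 := h.ne_pair 2 15 (by norm_num) (by norm_num) (by norm_num)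
  have t := h.A_add_two
  have s14 := h.step_pos 14 (by norm_num)
  have s15 := h.step_pos 15 (by norm_num)
  have s16 := h.step_pos 16 (by norm_num)
  have s17 := h.superadd 17
  have s18 := h.superadd 18
  have s19 := h.superadd 19
  have s20 := h.superadd 20
  have e12 := h.add_four_lt (hE 12 (by norm_num) (by norm_num))
  have e13 := h.add_four_lt (hE 13 (by norm_num) (by norm_num))
  have e14 := h.add_four_lt (hE 14 (by norm_num) (by norm_num))
  have e15 := h.add_four_lt (hE 15 (by norm_num) (by norm_num))
  have e16 := h.add_four_lt (hE 16 (by norm_num) (by norm_num))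
  have e17 := h.add_four_lt (hE 17 (by norm_num) (by norm_num))
  have e18 := h.add_four_lt (hE 18 (by norm_num) (by norm_num))
  have e19 := h.add_four_lt (hE 19 (by norm_num) (by norm_num))
  have e23 := h.add_four_lt (hE 23 (by norm_num) (by norm_num))
  have e24 := h.add_four_lt (hE 24 (by norm_num) (by norm_num))
  have u14 := h.step_le (n := 14) (by norm_num) (by norm_num) (by norm_num)
  have u15 := h.step_le (n := 15) (by norm_num) (by norm_num) (by norm_num)
  have u16 := h.step_le (n := 16) (by norm_num) (by norm_num) (by norm_num)
  have u17 := h.step_le (n := 17) (by norm_num) (by norm_num) (by norm_num)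
  norm_num [h.recurrence_sub_one, h.A_nonpos, h.A_eq_self]
    at t s14 s15 s16 s17 s18 s19 s20 e12 e13 e14 e15 e16 e17 e18 e19 e23 e24 u14 u15 u16 u17
  norm_num [h.recurrence_sub_one, h.A_nonpos, h.A_eq_self] at n15 hd
  rcases hd with hd | hd
  · linarith
  · have n16 := hd 2 16 (by norm_num) (by norm_num) (by norm_num)
    have n17 := hd 3 17 (by norm_num) (by norm_num) (by norm_num)
    norm_num [h.recurrence_sub_one, h.A_nonpos, h.A_eq_self] at n16 n17
    obtain h15 | h15 : A 15 = 16 ∨ A 15 = 18 := by omega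
    · linarith
    · obtain h16 | h16 | h16 : A 16 = 19 ∨ A 16 = 21 ∨ A 16 = 22 := by omega
      · obtain h17 | h17 | h17 | h17 : A 17 = 20 ∨ A 17 = 21 ∨ A 17 = 23 ∨ A 17 = 24 := by omega
        all_goals linarith
      all_goals linarith

/-- The gap inequality on the initial range propagates to all indices. -/
theorem gap_of_range (h : SlidModel k c p A T) {d : ℤ} (hd : 1 ≤ d)
    (hC : ∀ n, c + d + 1 ≤ n → n ≤ k + c + 1 + d → A (n + c) + A (n - d) < A (n + 1) + A n)
    (hB : T (k + c) < A (k + c + 1) + A (c + 1))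
    (hE : ∀ n, c + 1 ≤ n → n ≤ k + c + d + 1 → T (n + c) < A n + A (n + 1))
    (hq : A (p + 3) ≤ p + 4 ∨
      ∀ i n, 1 ≤ i → i + p + 1 < n → n ≤ k + c + 1 → A n ≠ A i + A (i + p + 1)) :
    ∀ n, c + 1 ≤ n → T (n + c) < A n + A (n + 1) := by
  have hk := h.k_eq
  have hc := h.c_pos
  have hp := h.p_pos
  rcases le_or_gt d (k - 2 * c - 2) with hdk | hdk
  · exact h.gap_of_small_d hd hdk hC hB hE
  have hE' : ∀ n, c + 1 ≤ n → n ≤ 2 * k - c → T (n + c) < A n + A (n + 1) :=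
    fun n h1 h2 => hE n h1 (by omega)
  have hcp : c < p := by
    by_contra! hpc
    have e := hE (c + 1) le_rfl (by omega)
    have t := h.T_two_le (c + 1 + c)
    have m1 := h.A_mono (show c + 1 + 1 ≤ c + 1 + c by omega)
    have m2 := h.A_mono (show c + 1 ≤ c + 1 + c - p by omega)
    omega
  rcases le_or_gt (3 * c + 3) p with hp3 | hp3
  · exact h.gap_of_three_mul_lt hp3 hE'
  rcases hc.eq_or_lt with rfl | hc2
  · obtain rfl | rfl | rfl | rfl : p = 2 ∨ p = 3 ∨ p = 4 ∨ p = 5 := by omega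
    all_goals norm_num at hk; subst hk
    · exact (h.not_gap_three_one fun n h1 h2 => hE n h1 (by omega)).elim
    · exact h.gap_four_one hE'
    · exact h.gap_five_one hE'
    · exact h.gap_six_one hE'
  have hquad := h.quadratic_le (by omega) hcp hE'
  have hc5 : c ≤ 5 := by nlinarith
  obtain rfl | rfl | rfl | rfl : c = 2 ∨ c = 3 ∨ c = 4 ∨ c = 5 := by omega
  · obtain rfl | rfl | rfl | rfl | rfl : p = 4 ∨ p = 5 ∨ p = 6 ∨ p = 7 ∨ p = 8 := by omega
    all_goals norm_num at hk; subst hk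
    · exact (h.not_gap_six_two hE').elim
    · rcases le_or_gt 3 d with hd3 | hd3
      · exact (h.not_gap_seven_two fun n h1 h2 => hE n h1 (by omega)).elim
      · obtain rfl : d = 2 := by omega
        exact (h.not_gap_seven_two_of_C hC).elim
    · exact h.gap_eight_two hE'
    · exact h.gap_nine_two hE'
    · exact h.gap_ten_two hE'
  · obtain rfl | rfl | rfl | rfl | rfl : p = 7 ∨ p = 8 ∨ p = 9 ∨ p = 10 ∨ p = 11 := by omega
    all_goals norm_num at hk; subst hk
    · exact (h.not_gap_ten_three hE').elim
    · exact (h.not_gap_eleven_three hE').elim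
    · exact h.gap_twelve_three hE'
    · exact h.gap_thirteen_three hE'
    · exact h.gap_fourteen_three hE'
  · obtain rfl | rfl | rfl : p = 12 ∨ p = 13 ∨ p = 14 := by omega
    all_goals norm_num at hk; subst hk
    · exact (h.not_gap_sixteen_four (by norm_num at hq ⊢; exact hq) hE').elim
    · exact h.gap_seventeen_four hE'
    · exact h.gap_eighteen_four hE'
  · obtain rfl : p = 17 := by omega
    norm_num at hk
    subst hk
    exact h.gap_twentytwo_five hE'

end SlidModel

/-- The extension by zero of a sequence of naturals, indexed from `1`, to the integers. -/
def extendZero (a : ℕ → ℕ) (n : ℤ) : ℤ := if n ≤ 0 then 0 else a n.toNat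

/-- The sum of `A` along steps of length `p` down from `n`. -/
def stepSum (p : ℕ) (A : ℤ → ℤ) (n : ℤ) : ℤ := ∑ i ∈ Finset.range n.toNat, A (n - i * p)

/-- The sequence agreeing with `a` up to index `m` and continued by `b n = b (n-1) + b (n-1-k)`. -/
def extendRec (k m : ℕ) (a : ℕ → ℕ) (n : ℕ) : ℕ :=
  if n ≤ m then a n else extendRec k m a (n - 1) + extendRec k m a (n - 1 - k)
termination_by n
decreasing_by all_goals omega

lemma extendZero_of_nonpos (a : ℕ → ℕ) {n : ℤ} (hn : n ≤ 0) : extendZero a n = 0 := if_pos hn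

lemma extendZero_natCast (a : ℕ → ℕ) {n : ℕ} (hn : 1 ≤ n) : extendZero a n = a n := by
  rw [extendZero, if_neg (by omega), Int.toNat_natCast]

lemma extendZero_nonneg (a : ℕ → ℕ) (n : ℤ) : 0 ≤ extendZero a n := by
  unfold extendZero
  split_ifs <;> positivity

lemma extendZero_congr {a b : ℕ → ℕ} {N : ℕ} (hab : ∀ n, 1 ≤ n → n ≤ N → a n = b n) {n : ℤ}
    (hn : n ≤ N) : extendZero a n = extendZero b n := by
  unfold extendZero
  split_ifs with h0
  · rfl
  · rw [hab _ (by omega) (by omega)]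

lemma stepSum_congr {a b : ℕ → ℕ} {N : ℕ} (hab : ∀ n, 1 ≤ n → n ≤ N → a n = b n) (p : ℕ) {n : ℤ}
    (hn : n ≤ N) : stepSum p (extendZero a) n = stepSum p (extendZero b) n := by
  refine Finset.sum_congr rfl fun i _ => extendZero_congr hab ?_
  have : (0 : ℤ) ≤ i * p := by positivity
  omega

lemma stepSum_eq_sum_range {p : ℕ} (hp : 1 ≤ p) (a : ℕ → ℕ) {n : ℤ} {m : ℕ} (hm : n ≤ m) :
    stepSum p (extendZero a) n = ∑ i ∈ Finset.range m, extendZero a (n - i * p) := by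
  refine Finset.sum_subset (Finset.range_mono (by omega)) fun i _ hi => extendZero_of_nonpos a ?_
  rw [Finset.mem_range, not_lt] at hi
  have : (i : ℤ) ≤ i * p := le_mul_of_one_le_right (by positivity) (by exact_mod_cast hp)
  omega

lemma stepSum_of_nonpos (p : ℕ) (A : ℤ → ℤ) {n : ℤ} (hn : n ≤ 0) : stepSum p A n = 0 := by
  rw [stepSum, Int.toNat_of_nonpos hn, Finset.range_zero, Finset.sum_empty]

lemma stepSum_step {p : ℕ} (hp : 1 ≤ p) (a : ℕ → ℕ) (n : ℤ) :
    stepSum p (extendZero a) n = extendZero a n + stepSum p (extendZero a) (n - p) := by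
  rw [stepSum_eq_sum_range hp a (show n ≤ (n.toNat + 1 : ℕ) by omega),
    stepSum_eq_sum_range hp a (show n - p ≤ n.toNat by omega), Finset.sum_range_succ', add_comm]
  congr 1
  · simp
  · refine Finset.sum_congr rfl fun i _ => ?_
    congr 1
    push_cast
    ring

lemma stepSum_mono {p : ℕ} (hp : 1 ≤ p) {a : ℕ → ℕ} (ha : Monotone (extendZero a)) :
    Monotone (stepSum p (extendZero a)) := by
  intro m n hmn
  rw [stepSum_eq_sum_range hp a (show m ≤ n.toNat by omega)]
  exact Finset.sum_le_sum fun i _ => ha (by omega)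

section SlidSeq

variable {S : Set ℕ} {a : ℕ → ℕ}

lemma SlidDecomp.mono {m n t : ℕ} (h : SlidDecomp S a m t) (hmn : m ≤ n) : SlidDecomp S a n t := by
  obtain ⟨L, hL, hleg, hs⟩ := h
  exact ⟨L, hL.trans (Finset.Icc_subset_Icc_right hmn), hleg, hs⟩

lemma slidDecomp_zero (n : ℕ) : SlidDecomp S a n 0 :=
  ⟨∅, Finset.empty_subset _, by simp [SlidLegal], by simp⟩

lemma slidDecomp_self (h0 : 0 ∉ S) {i n : ℕ} (hi : 1 ≤ i) (hn : i ≤ n) : SlidDecomp S a n (a i) :=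
  ⟨{i}, by simp [hi, hn], by simp [SlidLegal, h0], by simp⟩

lemma slidDecomp_pair (h0 : 0 ∉ S) {i q n : ℕ} (hi : 1 ≤ i) (hq : q ∉ S) (hq0 : 1 ≤ q)
    (hn : i + q ≤ n) : SlidDecomp S a n (a i + a (i + q)) := by
  refine ⟨{i, i + q}, ?_, ?_, (Finset.sum_pair (by omega)).symm⟩
  · intro x hx
    rw [Finset.mem_insert, Finset.mem_singleton] at hx
    rw [Finset.mem_Icc]
    omega
  · intro x hx y hy
    rw [Finset.mem_insert, Finset.mem_singleton] at hx hy
    have : ((x : ℤ) - y).natAbs = 0 ∨ ((x : ℤ) - y).natAbs = q := by omega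
    rcases this with h | h <;> rwa [h]

lemma SlidLegal.subset {L M : Finset ℕ} (h : SlidLegal S M) (hLM : L ⊆ M) : SlidLegal S L :=
  fun i hi j hj => h i (hLM hi) j (hLM hj)

namespace IsSlidSeq

lemma pos (ha : IsSlidSeq S a) {n : ℕ} (hn : 1 ≤ n) : 0 < a n := (ha n hn).1.1

lemma not_decomp (ha : IsSlidSeq S a) {n : ℕ} (hn : 1 ≤ n) : ¬ SlidDecomp S a (n - 1) (a n) :=
  (ha n hn).1.2

lemma decomp_of_lt (ha : IsSlidSeq S a) {n m : ℕ} (hm : m < a (n + 1)) : SlidDecomp S a n m := by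
  rcases Nat.eq_zero_or_pos m with rfl | h0
  · exact slidDecomp_zero n
  · by_contra hcon
    exact absurd ((ha (n + 1) (by omega)).2 ⟨h0, hcon⟩) (by omega)

lemma le_of_not_decomp (ha : IsSlidSeq S a) {n m : ℕ} (hm : ¬ SlidDecomp S a n m) :
    a (n + 1) ≤ m := by
  by_contra! hcon
  exact hm (ha.decomp_of_lt hcon)

lemma lt_succ (ha : IsSlidSeq S a) (h0 : 0 ∉ S) {n : ℕ} (hn : 1 ≤ n) : a n < a (n + 1) := by
  by_contra! hcon
  have hnot : ¬ SlidDecomp S a n (a (n + 1)) := ha.not_decomp (n := n + 1) (by omega)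
  rcases hcon.eq_or_lt with he | hl
  · exact hnot (he ▸ slidDecomp_self h0 hn le_rfl)
  · have hd : SlidDecomp S a (n - 1) (a (n + 1)) :=
      ha.decomp_of_lt (by rwa [Nat.sub_add_cancel hn])
    exact hnot (hd.mono (by omega))

lemma lt_of_lt (ha : IsSlidSeq S a) (h0 : 0 ∉ S) {m n : ℕ} (hm : 1 ≤ m) (hmn : m < n) :
    a m < a n := by
  induction n, hmn using Nat.le_induction with
  | base => exact ha.lt_succ h0 hm
  | succ n hmn ih => exact ih.trans (ha.lt_succ h0 (by omega))

lemma extendZero_mono (ha : IsSlidSeq S a) (h0 : 0 ∉ S) : Monotone (extendZero a) := by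
  intro m n hmn
  rcases le_or_gt m 0 with hm | hm
  · rw [extendZero_of_nonpos a hm]
    exact extendZero_nonneg a n
  · lift m to ℕ using hm.le
    lift n to ℕ using hm.le.trans hmn
    rw [extendZero_natCast a (by omega), extendZero_natCast a (by omega)]
    rcases hmn.eq_or_lt with he | hl
    · rw [show m = n by exact_mod_cast he]
    · exact_mod_cast (ha.lt_of_lt h0 (by omega) (by exact_mod_cast hl)).le

/-- Legal sums are bounded by the sum along steps of length `p`. -/
lemma sum_le (ha : IsSlidSeq S a) (h0 : 0 ∉ S) {p : ℕ} (hp : 1 ≤ p)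
    (hS : ∀ i, 1 ≤ i → i < p → i ∈ S) (n : ℕ) :
    ∀ L ⊆ Finset.Icc 1 n, SlidLegal S L →
      ((∑ i ∈ L, a i : ℕ) : ℤ) ≤ stepSum p (extendZero a) n := by
  induction n using Nat.strong_induction_on with
  | _ n ih =>
    intro L hL hleg
    have hmono := stepSum_mono hp (ha.extendZero_mono h0)
    rcases Nat.eq_zero_or_pos n with rfl | hn
    · have : L = ∅ := by simpa using hL
      simp [this, stepSum]
    by_cases hnL : n ∈ L
    · have hsub : L.erase n ⊆ Finset.Icc 1 (n - p) := by
        intro x hx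
        have hx' := Finset.mem_of_mem_erase hx
        have hxn := Finset.ne_of_mem_erase hx
        have hxI := Finset.mem_Icc.1 (hL hx')
        have hd := hleg n hnL x hx'
        rw [Finset.mem_Icc]
        refine ⟨hxI.1, ?_⟩
        by_contra! hlt
        exact hd (hS _ (by omega) (by omega))
      have i := ih (n - p) (by omega) _ hsub (hleg.subset (Finset.erase_subset n L))
      rw [← Finset.add_sum_erase L a hnL, stepSum_step hp, extendZero_natCast a hn]
      push_cast at i ⊢
      rcases le_or_gt p n with hpn | hpn
      · rw [Nat.cast_sub hpn] at i
        omega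
      · rw [Nat.sub_eq_zero_of_le hpn.le] at i
        rw [stepSum_of_nonpos p _ (show (n : ℤ) - p ≤ 0 by omega)]
        rw [Nat.cast_zero, stepSum_of_nonpos p _ le_rfl] at i
        omega
    · have hsub : L ⊆ Finset.Icc 1 (n - 1) := by
        intro x hx
        have hxI := Finset.mem_Icc.1 (hL hx)
        have hxn : x ≠ n := fun h => hnL (h ▸ hx)
        rw [Finset.mem_Icc]
        omega
      exact (ih (n - 1) (by omega) L hsub hleg).trans (hmono (by omega))

lemma le_stepSum_add_one (ha : IsSlidSeq S a) (h0 : 0 ∉ S) {p : ℕ} (hp : 1 ≤ p)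
    (hS : ∀ i, 1 ≤ i → i < p → i ∈ S) (n : ℕ) :
    (a (n + 1) : ℤ) ≤ stepSum p (extendZero a) n + 1 := by
  by_contra! hcon
  have hpos : 0 ≤ stepSum p (extendZero a) n :=
    Finset.sum_nonneg fun i _ => extendZero_nonneg a _
  obtain ⟨L, hL, hleg, hs⟩ := ha.decomp_of_lt (n := n)
    (m := (stepSum p (extendZero a) n + 1).toNat) (by omega)
  have := ha.sum_le h0 hp hS n L hL hleg
  rw [← hs] at this
  omega

lemma add_le_succ (ha : IsSlidSeq S a) (h0 : 0 ∉ S) {k : ℕ} (hS : ∀ i, k < i → i ∉ S) {n : ℕ}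
    (hn : k < n) : a n + a (n - k) ≤ a (n + 1) := by
  by_contra! hcon
  refine ha.not_decomp (n := n + 1) (by omega) ?_
  rw [Nat.add_sub_cancel]
  have hlt := ha.lt_succ h0 (show 1 ≤ n by omega)
  obtain ⟨L, hL, hleg, hs⟩ : SlidDecomp S a (n - k - 1) (a (n + 1) - a n) :=
    ha.decomp_of_lt (by rw [show n - k - 1 + 1 = n - k by omega]; omega)
  have hnL : n ∉ L := fun h => by
    have := Finset.mem_Icc.1 (hL h)
    omega
  refine ⟨insert n L, ?_, ?_, ?_⟩
  · intro x hx
    rw [Finset.mem_Icc]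
    rcases Finset.mem_insert.1 hx with rfl | hx
    · omega
    · have := Finset.mem_Icc.1 (hL hx)
      omega
  · intro x hx y hy
    rcases Finset.mem_insert.1 hx with h1 | h1 <;> rcases Finset.mem_insert.1 hy with h2 | h2
    · simpa [h1, h2] using h0
    · have := Finset.mem_Icc.1 (hL h2)
      exact hS _ (by omega)
    · have := Finset.mem_Icc.1 (hL h1)
      exact hS _ (by omega)
    · exact hleg x h1 y h2
  · rw [Finset.sum_insert hnL, ← hs]
    omega

lemma recurrence_of_stepSum_lt (ha : IsSlidSeq S a) (h0 : 0 ∉ S) {p : ℕ} (hp : 1 ≤ p)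
    (hS : ∀ i, 1 ≤ i → i < p → i ∈ S) {k : ℕ} (hkS : k ∈ S) (hS' : ∀ i, k < i → i ∉ S) {n : ℕ}
    (hn : k < n) (hB : stepSum p (extendZero a) (n - 1) < a n + a (n - k)) :
    a (n + 1) = a n + a (n - k) := by
  refine le_antisymm (ha.le_of_not_decomp ?_) (ha.add_le_succ h0 hS' hn)
  rintro ⟨L, hL, hleg, hs⟩
  by_cases hnL : n ∈ L
  · rw [← Finset.add_sum_erase L a hnL] at hs
    refine ha.not_decomp (n := n - k) (by omega)
      ⟨L.erase n, fun x hx => ?_, hleg.subset (Finset.erase_subset n L), by omega⟩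
    have hx' := Finset.mem_of_mem_erase hx
    have hxI := Finset.mem_Icc.1 (hL hx')
    have hle : a x ≤ ∑ i ∈ L.erase n, a i :=
      Finset.single_le_sum (f := a) (fun _ _ => Nat.zero_le _) hx
    have hne : x ≠ n - k := fun h => by
      refine hleg n hnL x hx' ?_
      rwa [h, show ((n : ℤ) - (n - k : ℕ)).natAbs = k by omega]
    rw [Finset.mem_Icc]
    refine ⟨hxI.1, ?_⟩
    by_contra! hlt
    have := ha.lt_of_lt h0 (m := n - k) (n := x) (by omega) (by omega)
    omega
  · have hsub : L ⊆ Finset.Icc 1 (n - 1) := by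
      intro x hx
      have hxI := Finset.mem_Icc.1 (hL hx)
      have hxn : x ≠ n := fun h => hnL (h ▸ hx)
      rw [Finset.mem_Icc]
      omega
    have := ha.sum_le h0 hp hS (n - 1) L hsub hleg
    rw [← hs, Nat.cast_sub (by omega)] at this
    push_cast at this
    omega

end IsSlidSeq

end SlidSeq

lemma extendRec_of_le {k m n : ℕ} (a : ℕ → ℕ) (hn : n ≤ m) : extendRec k m a n = a n := by
  rw [extendRec, if_pos hn]

lemma extendRec_succ {k m n : ℕ} (a : ℕ → ℕ) (hn : m ≤ n) :
    extendRec k m a (n + 1) = extendRec k m a n + extendRec k m a (n - k) := by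
  conv_lhs => rw [extendRec, if_neg (by omega)]
  rfl

lemma extendRec_pos {k m : ℕ} (hkm : k < m) {a : ℕ → ℕ} (ha : ∀ n, 1 ≤ n → 0 < a n) {n : ℕ} :
    1 ≤ n → 0 < extendRec k m a n := by
  induction n using Nat.strong_induction_on with
  | _ n ih =>
    intro hn
    rcases le_or_gt n m with h | h
    · rw [extendRec_of_le a h]
      exact ha n hn
    · obtain ⟨n, rfl⟩ := Nat.exists_eq_add_of_le' hn
      rw [extendRec_succ a (by omega)]
      exact Nat.add_pos_left (ih n (by omega) (by omega)) _

namespace IsSlidSeq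

variable {S : Set ℕ} {a : ℕ → ℕ}

lemma slidModel (ha : IsSlidSeq S a) (h0 : 0 ∉ S) {k c p : ℕ} (hp : 1 ≤ p) (hc : 1 ≤ c)
    (hk : k = p + c) (hS : ∀ i, 1 ≤ i → i < p → i ∈ S) (hpS : p ∉ S)
    (hS' : ∀ i, k < i → i ∉ S) :
    SlidModel k c p (extendZero (extendRec k (k + c + 1) a))
      (stepSum p (extendZero (extendRec k (k + c + 1) a))) := by
  set b := extendRec k (k + c + 1) a with hb
  have hab : ∀ n, 1 ≤ n → n ≤ k + c + 1 → a n = b n := fun n _ hn => (extendRec_of_le a hn).symm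
  have hbpos : ∀ n, 1 ≤ n → 0 < b n := fun n hn =>
    extendRec_pos (by omega) (fun _ => ha.pos) hn
  have hrec : ∀ n : ℤ, (k : ℤ) + c < n →
      extendZero b (n + 1) = extendZero b n + extendZero b (n - k) := by
    intro n hn
    lift n to ℕ using by omega
    rw [show (n : ℤ) + 1 = (n + 1 : ℕ) by push_cast; rfl,
      show (n : ℤ) - k = (n - k : ℕ) by omega, extendZero_natCast b (by omega),
      extendZero_natCast b (by omega), extendZero_natCast b (by omega), hb,
      extendRec_succ a (by omega)]
    push_cast
    rfl
  have hstep : ∀ n : ℤ, 0 ≤ n → extendZero b n < extendZero b (n + 1) := by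
    intro n hn
    rcases hn.eq_or_lt with rfl | hn
    · rw [extendZero_of_nonpos b le_rfl, show (0 : ℤ) + 1 = (1 : ℕ) by norm_num,
        extendZero_natCast b le_rfl]
      exact_mod_cast hbpos 1 le_rfl
    rcases le_or_gt n (k + c) with h | h
    · lift n to ℕ using hn.le
      rw [show (n : ℤ) + 1 = (n + 1 : ℕ) by push_cast; rfl, extendZero_natCast b (by omega),
        extendZero_natCast b (by omega), ← hab n (by omega) (by omega),
        ← hab (n + 1) (by omega) (by omega)]
      exact_mod_cast ha.lt_succ h0 (by omega)
    · rw [hrec n h]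
      lift n - (k : ℤ) to ℕ using by omega with m hm
      rw [extendZero_natCast b (by omega)]
      have := hbpos m (by omega)
      omega
  have hpair : ∀ q : ℕ, 1 ≤ q → q ∉ S → ∀ i n : ℤ, 1 ≤ i → i + q < n → n ≤ k + c + 1 →
      extendZero b n ≠ extendZero b i + extendZero b (i + q) := by
    intro q hq hqS i n hi hin hn
    lift i to ℕ using by omega
    lift n to ℕ using by omega
    rw [show (i : ℤ) + q = (i + q : ℕ) by push_cast; rfl, extendZero_natCast b (by omega),
      extendZero_natCast b (by omega), extendZero_natCast b (by omega),
      ← hab n (by omega) (by omega), ← hab i (by omega) (by omega),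
      ← hab (i + q) (by omega) (by omega)]
    intro h
    refine ha.not_decomp (n := n) (by omega) ?_
    rw [show a n = a i + a (i + q) by exact_mod_cast h]
    exact slidDecomp_pair h0 (by omega) hqS hq (by omega)
  refine
    { c_pos := by exact_mod_cast hc
      p_pos := by exact_mod_cast hp
      k_eq := by exact_mod_cast hk
      A_nonpos := fun n hn => extendZero_of_nonpos b hn
      T_nonpos := fun n hn => stepSum_of_nonpos p _ hn
      T_step := stepSum_step hp b
      recurrence := hrec
      superadd := ?_
      step_pos := hstep
      upper := ?_
      ne_pair := hpair p hp hpS }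
  · intro n
    rcases le_or_gt n k with h | h
    · rw [extendZero_of_nonpos b (show n - k ≤ 0 by omega), add_zero]
      rcases le_or_gt 0 n with hn | hn
      · exact (hstep n hn).le
      · rw [extendZero_of_nonpos b hn.le]
        exact extendZero_nonneg b _
    rcases le_or_gt n (k + c) with h' | h'
    · lift n to ℕ using by omega
      rw [show (n : ℤ) + 1 = (n + 1 : ℕ) by push_cast; rfl,
        show (n : ℤ) - k = (n - k : ℕ) by omega, extendZero_natCast b (by omega),
        extendZero_natCast b (by omega), extendZero_natCast b (by omega),
        ← hab n (by omega) (by omega), ← hab (n + 1) (by omega) (by omega),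
        ← hab (n - k) (by omega) (by omega)]
      exact_mod_cast ha.add_le_succ h0 hS' (by omega)
    · exact (hrec n h').ge
  · intro n hn h
    lift n to ℕ using hn
    rw [← stepSum_congr hab p (n := n) (by push_cast; omega),
      show (n : ℤ) + 1 = (n + 1 : ℕ) by push_cast; rfl, extendZero_natCast b (by omega),
      ← hab (n + 1) (by omega) (by omega)]
    exact ha.le_stepSum_add_one h0 hp hS n

/-- If `p + 1 ∈ S`, then `p + 4` is not a legal sum of `a 1, …, a (p + 2)`. -/
lemma apply_add_three_le (ha : IsSlidSeq S a) (h0 : 0 ∉ S) {p : ℕ} (hp : 1 ≤ p)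
    (hS : ∀ i, 1 ≤ i → i < p → i ∈ S) (hpS : p + 1 ∈ S)
    (hval : ∀ i, 1 ≤ i → i ≤ p + 1 → a i = i) (hval' : a (p + 2) = p + 3) :
    a (p + 3) ≤ p + 4 := by
  refine ha.le_of_not_decomp (n := p + 2) ?_
  rintro ⟨L, hL, hleg, hs⟩
  by_cases hpL : p + 2 ∈ L
  · have hsub : L.erase (p + 2) ⊆ {2} := by
      intro x hx
      have hx' := Finset.mem_of_mem_erase hx
      have hxn := Finset.ne_of_mem_erase hx
      have hxI := Finset.mem_Icc.1 (hL hx')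
      rw [Finset.mem_singleton]
      by_contra hx2
      refine hleg _ hpL x hx' ?_
      rcases hxI.1.eq_or_lt with rfl | h1
      · rwa [show (((p + 2 : ℕ) : ℤ) - (1 : ℕ)).natAbs = p + 1 by omega]
      · exact hS _ (by omega) (by omega)
    rw [← Finset.add_sum_erase L a hpL, hval'] at hs
    rcases Finset.subset_singleton_iff.1 hsub with h | h
    · rw [h, Finset.sum_empty] at hs
      omega
    · rw [h, Finset.sum_singleton, hval 2 (by omega) (by omega)] at hs
      omega
  · have hsub : L ⊆ Finset.Icc 1 (p + 1) := by
      intro x hx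
      have hxI := Finset.mem_Icc.1 (hL hx)
      have hxn : x ≠ p + 2 := fun h => hpL (h ▸ hx)
      rw [Finset.mem_Icc]
      omega
    have h := ha.sum_le h0 (by omega) hS (p + 1) L hsub hleg
    rw [← hs, stepSum_step (by omega), show ((p + 1 : ℕ) : ℤ) - p = 1 by push_cast; ring,
      stepSum_step (by omega), stepSum_of_nonpos p _ (show (1 : ℤ) - p ≤ 0 by omega),
      extendZero_natCast a (by omega), show (1 : ℤ) = (1 : ℕ) by norm_num,
      extendZero_natCast a le_rfl, hval (p + 1) (by omega) le_rfl,
      hval 1 le_rfl (by omega)] at h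
    omega

end IsSlidSeq

/-- The sum in the predicate `B` is a sum along steps of length `p`. -/
lemma sum_filter_eq_stepSum {p : ℕ} (hp : 1 ≤ p) (a : ℕ → ℕ) (n : ℕ) :
    ((∑ i ∈ (Finset.range (n + 1)).filter (fun i => i * p < n), a (n - i * p) : ℕ) : ℤ) =
      stepSum p (extendZero a) n := by
  rw [stepSum_eq_sum_range hp a (show (n : ℤ) ≤ (n + 1 : ℕ) by omega), Finset.sum_filter,
    Nat.cast_sum]
  refine Finset.sum_congr rfl fun i _ => ?_
  split_ifs with h
  · rw [← extendZero_natCast a (by omega), Nat.cast_sub h.le, Nat.cast_mul]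
  · rw [extendZero_of_nonpos a (by rw [sub_nonpos]; exact_mod_cast not_lt.1 h), Nat.cast_zero]

/-- A sequence obeying the recurrence from `k + c + 1` up to `N` agrees there with its
recursive extension. -/
lemma extendRec_eq {k m N : ℕ} {a : ℕ → ℕ}
    (ha : ∀ n, m ≤ n → n < N → a (n + 1) = a n + a (n - k)) :
    ∀ n, n ≤ N → extendRec k m a n = a n := by
  intro n
  induction n using Nat.strong_induction_on with
  | _ n ih =>
    intro hn
    rcases le_or_gt n m with h | h
    · exact extendRec_of_le a h
    · obtain ⟨n, rfl⟩ := Nat.exists_eq_add_of_lt h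
      rw [extendRec_succ a (by omega), ih _ (by omega) (by omega), ih _ (by omega) (by omega),
        ha _ (by omega) (by omega)]

/-- The gap inequality for the recursive extension of `a` forces `a` to obey the recurrence. -/
lemma IsSlidSeq.recurrence_of_gap {S : Set ℕ} {a : ℕ → ℕ} (ha : IsSlidSeq S a) (h0 : 0 ∉ S)
    {p : ℕ} (hp : 1 ≤ p) (hS : ∀ i, 1 ≤ i → i < p → i ∈ S) {k : ℕ} (hkS : k ∈ S)
    (hS' : ∀ i, k < i → i ∉ S) {m : ℕ} (hkm : k < m)
    (hB : ∀ n, m ≤ n → stepSum p (extendZero (extendRec k m a)) (n - 1) <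
      extendRec k m a n + extendRec k m a (n - k)) (n : ℕ) (hn : m ≤ n) :
    a (n + 1) = a n + a (n - k) := by
  induction n using Nat.strong_induction_on with
  | _ n ih =>
    have heq := extendRec_eq (k := k) (m := m) (N := n) fun i h1 h2 => ih i h2 h1
    refine ha.recurrence_of_stepSum_lt h0 hp hS hkS hS' (by omega) ?_
    have := hB n hn
    rwa [heq n le_rfl, heq (n - k) (by omega),
      stepSum_congr (fun i _ hi => heq i hi) p (show (n : ℤ) - 1 ≤ n by omega)] at this

lemma IsSlidSeq.dichotomy {S : Set ℕ} {a : ℕ → ℕ} (ha : IsSlidSeq S a) (h0 : 0 ∉ S)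
    {k c p : ℕ} (hp : 1 ≤ p) (hc : 1 ≤ c) (hk : k = p + c) (hS : ∀ i, 1 ≤ i → i < p → i ∈ S)
    (hpS : p ∉ S) (hS' : ∀ i, k < i → i ∉ S) {A : ℤ → ℤ}
    (hA : A = extendZero (extendRec k (k + c + 1) a)) :
    A (p + 3) ≤ p + 4 ∨
      ∀ i n : ℤ, 1 ≤ i → i + p + 1 < n → n ≤ k + c + 1 → A n ≠ A i + A (i + p + 1) := by
  have hmodel := ha.slidModel h0 hp hc hk hS hpS hS'
  have hAa : ∀ n : ℕ, 1 ≤ n → n ≤ k + c + 1 → A n = a n := fun n h1 h2 => by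
    rw [hA, extendZero_natCast _ h1, extendRec_of_le a h2]
  rw [← hA] at hmodel
  by_cases hqS : p + 1 ∈ S
  · left
    have hval : ∀ i, 1 ≤ i → i ≤ p + 1 → a i = i := fun i h1 h2 => by
      have := hmodel.A_eq_self i (by omega) (by omega)
      rw [hAa i h1 (by omega)] at this
      exact_mod_cast this
    have hval' : a (p + 2) = p + 3 := by
      have := hmodel.A_add_two
      rw [show (p : ℤ) + 2 = (p + 2 : ℕ) by push_cast; rfl, hAa _ (by omega) (by omega)] at this
      exact_mod_cast this
    have := ha.apply_add_three_le h0 hp hS hqS hval hval'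
    rw [show (p : ℤ) + 3 = (p + 3 : ℕ) by push_cast; rfl, hAa _ (by omega) (by omega)]
    exact_mod_cast this
  · right
    intro i n hi hin hn h
    lift i to ℕ using by omega
    lift n to ℕ using by omega
    rw [show (i : ℤ) + p + 1 = (i + (p + 1) : ℕ) by push_cast; ring, hAa n (by omega) (by omega),
      hAa i (by omega) (by omega), hAa _ (by omega) (by omega)] at h
    refine ha.not_decomp (n := n) (by omega) ?_
    rw [show a n = a i + a (i + (p + 1)) by exact_mod_cast h]
    exact slidDecomp_pair h0 (by omega) hqS (by omega) (by omega)

theorem finite_check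
    (S : Finset ℕ) (hne : S.Nonempty) (hpos : ∀ s ∈ S, 0 < s)
    (k : ℕ) (hk : k = S.max' hne)
    (c : ℕ) (hc : 0 < c)
    (hleast : IsLeast {m | 0 < m ∧ m ∉ (S : Set ℕ)} (k - c))
    (a : ℕ → ℕ) (ha : IsSlidSeq ↑S a)
    (d : ℕ) (hd : 0 < d) (hk2 : 2 * (d : ℤ) - 4 * (c : ℤ) + 2 ≤ (k : ℤ))
    (hC : ∀ n, c + d + 1 ≤ n → n ≤ k + c + 1 + d →
      a (n + c) + a (n - d) < a (n + 1) + a n)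
    (hB : ∀ n, k + c + 1 ≤ n → n ≤ 2 * k + c + d + 2 →
      (∑ i ∈ (Finset.range n).filter (fun i => i * (k - c) < n - 1),
        a (n - 1 - i * (k - c))) < a n + a (n - k)) :
    ∀ n, k + c < n → a (n + 1) = a n + a (n - k) := by
  have hpk : 0 < k - c := hleast.1.1
  obtain ⟨p, hp⟩ : ∃ p, p = k - c := ⟨_, rfl⟩
  rw [← hp] at hleast hB hpk
  have hkp : k = p + c := by omega
  have h0 : 0 ∉ (S : Set ℕ) := fun h => (hpos 0 h).false
  have hS : ∀ i, 1 ≤ i → i < p → i ∈ (S : Set ℕ) := fun i h1 h2 => by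
    by_contra h
    exact absurd (hleast.2 ⟨h1, h⟩) (by omega)
  have hkS : k ∈ (S : Set ℕ) := hk ▸ S.max'_mem hne
  have hS' : ∀ i, k < i → i ∉ (S : Set ℕ) := fun i hi h =>
    absurd (S.le_max' i h) (by omega)
  have hB' : ∀ n : ℕ, k + c + 1 ≤ n → n ≤ 2 * k + c + d + 2 →
      stepSum p (extendZero a) (n - 1) < a n + a (n - k) := fun n h1 h2 => by
    have h := hB n h1 h2
    obtain ⟨n, rfl⟩ := Nat.exists_eq_add_of_le' (show 1 ≤ n by omega)
    rw [Nat.add_sub_cancel] at h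
    push_cast
    rw [add_sub_cancel_right, ← sum_filter_eq_stepSum hpk]
    exact_mod_cast h
  have hinit := extendRec_eq (k := k) (m := k + c + 1) (N := 2 * k + c + d + 3) (a := a)
    fun n h1 h2 => ha.recurrence_of_stepSum_lt h0 hpk hS hkS hS' (by omega)
      (hB' n h1 (by omega))
  have hmodel := ha.slidModel h0 hpk hc hkp hS hleast.1.2 hS'
  have hdich := ha.dichotomy h0 hpk hc hkp hS hleast.1.2 hS' rfl
  refine ha.recurrence_of_gap h0 hpk hS hkS hS' (m := k + c + 1) (by omega) ?_
  set b := extendRec k (k + c + 1) a with hb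
  set A := extendZero b with hA
  have hAa : ∀ n : ℕ, 1 ≤ n → n ≤ 2 * k + c + d + 3 → A n = a n := fun n h1 h2 => by
    rw [hA, extendZero_natCast b h1, hinit n h2]
  have hAB : ∀ n : ℕ, k + c + 1 ≤ n → n ≤ 2 * k + c + d + 2 →
      stepSum p A (n - 1) < A n + A (n - k) := fun n h1 h2 => by
    rw [show (n : ℤ) - k = (n - k : ℕ) by omega, hAa n (by omega) (by omega),
      hAa (n - k) (by omega) (by omega), hA,
      stepSum_congr (N := 2 * k + c + d + 3) (fun i _ hi => hinit i hi) p (by omega)]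
    exact hB' n h1 h2
  have hfirst : stepSum p A (k + c) < A (k + c + 1) + A (c + 1) := by
    have := hAB (k + c + 1) le_rfl (by omega)
    push_cast at this
    rwa [add_sub_cancel_right, show (k : ℤ) + c + 1 - k = c + 1 by ring] at this
  have hgap := hmodel.gap_of_range (d := d) (by omega) ?_ hfirst ?_ hdich
  · intro n hn
    suffices h : stepSum p A (n - 1) < A n + A (n - k) by
      rwa [show (n : ℤ) - k = (n - k : ℕ) by omega, hA, extendZero_natCast b (by omega),
        extendZero_natCast b (by omega)] at h
    rcases hn.eq_or_lt with rfl | hn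
    · exact hAB _ le_rfl (by omega)
    · have := (hmodel.gap_iff (n := n - k - 1) (by omega)).2 (hgap _ (by omega))
      rwa [show (n : ℤ) - k - 1 + k = n - 1 by ring, sub_add_cancel, sub_add_cancel] at this
  · intro n h1 h2
    lift n to ℕ using by omega
    have h := hC n (by omega) (by omega)
    rw [show (n : ℤ) + c = (n + c : ℕ) by push_cast; rfl, show (n : ℤ) - d = (n - d : ℕ) by omega,
      show (n : ℤ) + 1 = (n + 1 : ℕ) by push_cast; rfl, hAa _ (by omega) (by omega),
      hAa _ (by omega) (by omega), hAa _ (by omega) (by omega), hAa _ (by omega) (by omega)]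
    exact_mod_cast h
  · intro n h1 h2
    refine (hmodel.gap_iff h1).1 ?_
    lift n to ℕ using by omega
    have h := hAB (n + k + 1) (by omega) (by omega)
    push_cast at h
    rwa [add_sub_cancel_right, show (n : ℤ) + k + 1 - k = n + 1 by ring] at h
end
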